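/- For every integer n ≥ 2 there exists a constant c₁ = c₁(n), depending only on n, such that pc(D) ≤ c₁ for every weakly connected digraph D satisfying conditions (D1), (D2) and (D3). -/

import Mathlib

/-! ## Basic notions for graphs and digraphs

A digraph on a vertex type `V` is given by its arc relation `E : V → V → Prop`.
Simplicity and absence of 2-cycles is expressed by the hypothesis
`∀ u v, E u v → ¬ E v u`.  The underlying graph `G_D` is `SimpleGraph.fromRel E`. -/

/-- `G` contains an induced copy of the simple graph `H`. -/
def HasInducedCopyG {W V : Type} (H : SimpleGraph W) (G : SimpleGraph V) : Prop :=
  ∃ f : W → V, Function.Injective f ∧ ∀ a b : W, G.Adj (f a) (f b) ↔ H.Adj a b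

/-- The digraph `E` contains an induced copy of the digraph `H`. -/
def DigraphHasInducedCopy {W V : Type} (H : W → W → Prop) (E : V → V → Prop) : Prop :=
  ∃ f : W → V, Function.Injective f ∧ ∀ a b : W, E (f a) (f b) ↔ H a b

/-- The star `K_{1,n}` with one center and `n` leaves. -/
def StarG (n : ℕ) : SimpleGraph (Unit ⊕ Fin n) :=
  SimpleGraph.fromRel (fun a b =>
    match a, b with
    | Sum.inl _, Sum.inr _ => True
    | _, _ => False)

/-- The path `P_n` of order `n`. -/
def PathG (n : ℕ) : SimpleGraph (Fin n) :=
  SimpleGraph.fromRel (fun i j => i.val + 1 = j.val)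

/-- The graph `K*_n`: a complete graph on the `x_i` together with pendant edges `x_i y_i`. -/
def KStarG (n : ℕ) : SimpleGraph (Fin n ⊕ Fin n) :=
  SimpleGraph.fromRel (fun a b =>
    match a, b with
    | Sum.inl i, Sum.inl j => i ≠ j
    | Sum.inl i, Sum.inr j => i = j
    | _, _ => False)

/-- The graph `F^(1)_n` on `{x₁,x₂} ∪ {yᵢ} ∪ {zᵢ}`:
edges `x₁x₂, x₁y₁, x₁z₁` together with the two paths `y₁⋯y_n` and `z₁⋯z_n`. -/
def F1G (n : ℕ) : SimpleGraph (Fin 2 ⊕ Fin n ⊕ Fin n) :=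
  SimpleGraph.fromRel (fun a b =>
    match a, b with
    | Sum.inl i, Sum.inl j => i.val = 0 ∧ j.val = 1
    | Sum.inl i, Sum.inr (Sum.inl j) => i.val = 0 ∧ j.val = 0
    | Sum.inl i, Sum.inr (Sum.inr j) => i.val = 0 ∧ j.val = 0
    | Sum.inr (Sum.inl i), Sum.inr (Sum.inl j) => i.val + 1 = j.val
    | Sum.inr (Sum.inr i), Sum.inr (Sum.inr j) => i.val + 1 = j.val
    | _, _ => False)

/-- The single edge `y₁z₁` (used to build `F^(2)_n` and `F^(4)_n`). -/
def YZEdgeG (n : ℕ) : SimpleGraph (Fin 2 ⊕ Fin n ⊕ Fin n) :=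
  SimpleGraph.fromRel (fun a b =>
    match a, b with
    | Sum.inr (Sum.inl i), Sum.inr (Sum.inr j) => i.val = 0 ∧ j.val = 0
    | _, _ => False)

/-- `F^(2)_n = F^(1)_n + y₁z₁`. -/
def F2G (n : ℕ) : SimpleGraph (Fin 2 ⊕ Fin n ⊕ Fin n) := F1G n ⊔ YZEdgeG n

/-- The graph `F^(3)_n`: edges `x₁y₁, x₁z₁, x₂y₁, x₂z₁` together with the two paths. -/
def F3G (n : ℕ) : SimpleGraph (Fin 2 ⊕ Fin n ⊕ Fin n) :=
  SimpleGraph.fromRel (fun a b =>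
    match a, b with
    | Sum.inl _, Sum.inr (Sum.inl j) => j.val = 0
    | Sum.inl _, Sum.inr (Sum.inr j) => j.val = 0
    | Sum.inr (Sum.inl i), Sum.inr (Sum.inl j) => i.val + 1 = j.val
    | Sum.inr (Sum.inr i), Sum.inr (Sum.inr j) => i.val + 1 = j.val
    | _, _ => False)

/-- `F^(4)_n = F^(3)_n + y₁z₁`. -/
def F4G (n : ℕ) : SimpleGraph (Fin 2 ⊕ Fin n ⊕ Fin n) := F3G n ⊔ YZEdgeG n

/-- The digraph `D^(1)_n` on `{x₁} ∪ {yᵢ} ∪ {zᵢ}` with arcs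
`(x₁,y₁), (z₁,x₁), (y₁,z₁)`, `(y_{i+1}, y_i)` and `(z_i, z_{i+1})`. -/
def D1Rel (n : ℕ) : (Unit ⊕ Fin n ⊕ Fin n) → (Unit ⊕ Fin n ⊕ Fin n) → Prop := fun a b =>
  match a, b with
  | Sum.inl _, Sum.inr (Sum.inl j) => j.val = 0
  | Sum.inr (Sum.inr i), Sum.inl _ => i.val = 0
  | Sum.inr (Sum.inl i), Sum.inr (Sum.inr j) => i.val = 0 ∧ j.val = 0
  | Sum.inr (Sum.inl i), Sum.inr (Sum.inl j) => j.val + 1 = i.val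
  | Sum.inr (Sum.inr i), Sum.inr (Sum.inr j) => i.val + 1 = j.val
  | _, _ => False

/-- `D^(2)_n`: obtained from `D^(1)_n` by replacing the arc `(z₁,x₁)` by `(x₁,z₁)`. -/
def D2Rel (n : ℕ) : (Unit ⊕ Fin n ⊕ Fin n) → (Unit ⊕ Fin n ⊕ Fin n) → Prop := fun a b =>
  match a, b with
  | Sum.inl _, Sum.inr (Sum.inl j) => j.val = 0
  | Sum.inl _, Sum.inr (Sum.inr j) => j.val = 0
  | Sum.inr (Sum.inl i), Sum.inr (Sum.inr j) => i.val = 0 ∧ j.val = 0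
  | Sum.inr (Sum.inl i), Sum.inr (Sum.inl j) => j.val + 1 = i.val
  | Sum.inr (Sum.inr i), Sum.inr (Sum.inr j) => i.val + 1 = j.val
  | _, _ => False

/-- `D^(3)_n`: obtained from `D^(1)_n` by replacing the arc `(x₁,y₁)` by `(y₁,x₁)`. -/
def D3Rel (n : ℕ) : (Unit ⊕ Fin n ⊕ Fin n) → (Unit ⊕ Fin n ⊕ Fin n) → Prop := fun a b =>
  match a, b with
  | Sum.inr (Sum.inl i), Sum.inl _ => i.val = 0
  | Sum.inr (Sum.inr i), Sum.inl _ => i.val = 0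
  | Sum.inr (Sum.inl i), Sum.inr (Sum.inr j) => i.val = 0 ∧ j.val = 0
  | Sum.inr (Sum.inl i), Sum.inr (Sum.inl j) => j.val + 1 = i.val
  | Sum.inr (Sum.inr i), Sum.inr (Sum.inr j) => i.val + 1 = j.val
  | _, _ => False

/-- The transitive tournament `T_n`. -/
def TRel (n : ℕ) : Fin n → Fin n → Prop := fun i j => i < j

/-- A (nonempty) directed path in the digraph `E`, recorded as its list of vertices. -/
def IsDirPathList {V : Type} (E : V → V → Prop) (l : List V) : Prop :=
  l ≠ [] ∧ l.Nodup ∧ l.Chain' E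

/-- The path cover number of the subdigraph of `E` induced by `X`:
the minimum number of directed paths of `E[X]` whose vertex sets cover `X`. -/
noncomputable def pcOn {V : Type} (E : V → V → Prop) (X : Set V) : ℕ :=
  sInf {k | ∃ P : Finset (List V), P.card = k ∧
    (∀ l ∈ P, IsDirPathList E l ∧ ∀ v ∈ l, v ∈ X) ∧
    ∀ v ∈ X, ∃ l ∈ P, v ∈ l}

/-- The path partition number of the subdigraph of `E` induced by `X`:
the minimum number of pairwise vertex-disjoint directed paths of `E[X]`
whose vertex sets partition `X`. -/
noncomputable def ppOn {V : Type} (E : V → V → Prop) (X : Set V) : ℕ :=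
  sInf {k | ∃ P : Finset (List V), P.card = k ∧
    (∀ l ∈ P, IsDirPathList E l ∧ ∀ v ∈ l, v ∈ X) ∧
    (∀ v ∈ X, ∃ l ∈ P, v ∈ l) ∧
    ∀ l ∈ P, ∀ l' ∈ P, l ≠ l' → ∀ v ∈ l, v ∉ l'}

/-- A (nonempty) path in the simple graph `G`, recorded as its list of vertices. -/
def IsPathList {V : Type} (G : SimpleGraph V) (l : List V) : Prop :=
  l ≠ [] ∧ l.Nodup ∧ l.Chain' G.Adj

/-- The path cover number `pc(G)` of a simple graph `G`. -/
noncomputable def pcG {V : Type} (G : SimpleGraph V) : ℕ :=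
  sInf {k | ∃ P : Finset (List V), P.card = k ∧
    (∀ l ∈ P, IsPathList G l) ∧ ∀ v : V, ∃ l ∈ P, v ∈ l}

/-- The path partition number `pp(G)` of a simple graph `G`. -/
noncomputable def ppG {V : Type} (G : SimpleGraph V) : ℕ :=
  sInf {k | ∃ P : Finset (List V), P.card = k ∧
    (∀ l ∈ P, IsPathList G l) ∧ (∀ v : V, ∃ l ∈ P, v ∈ l) ∧
    ∀ l ∈ P, ∀ l' ∈ P, l ≠ l' → ∀ v ∈ l, v ∉ l'}

/-- A directed cycle in the digraph `E`, recorded as its list of vertices. -/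
def IsDirCycleList {V : Type} (E : V → V → Prop) (l : List V) : Prop :=
  ∃ h : l ≠ [], 3 ≤ l.length ∧ l.Nodup ∧ l.Chain' E ∧ E (l.getLast h) (l.head h)

/-- A member of a cycle cover/partition: a directed cycle, or a weakly connected
subdigraph of order at most two. -/
def IsCyclePartMember {V : Type} (E : V → V → Prop) (l : List V) : Prop :=
  IsDirCycleList E l ∨
    (l ≠ [] ∧ l.length ≤ 2 ∧ l.Nodup ∧ l.Chain' (fun a b => E a b ∨ E b a))

/-- The cycle partition number `cp(D)` of the digraph `E`. -/
noncomputable def cpNum {V : Type} (E : V → V → Prop) : ℕ :=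
  sInf {k | ∃ P : Finset (List V), P.card = k ∧
    (∀ l ∈ P, IsCyclePartMember E l) ∧
    (∀ v : V, ∃ l ∈ P, v ∈ l) ∧
    ∀ l ∈ P, ∀ l' ∈ P, l ≠ l' → ∀ v ∈ l, v ∉ l'}

/-- `v : Fin m → V` enumerates an induced path of the simple graph `G`. -/
def IsInducedPathEmb {V : Type} (G : SimpleGraph V) {m : ℕ} (v : Fin m → V) : Prop :=
  Function.Injective v ∧
    ∀ i j : Fin m, G.Adj (v i) (v j) ↔ (i.val + 1 = j.val ∨ j.val + 1 = i.val)

/-- `w : Fin m → V` enumerates an induced pseudo-path of the digraph `E`: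
the induced subdigraph on its image has a path as underlying graph. -/
def IsInducedPsPath {V : Type} (E : V → V → Prop) {m : ℕ} (w : Fin m → V) : Prop :=
  Function.Injective w ∧
    ∀ i j : Fin m, (E (w i) (w j) ∨ E (w j) (w i)) ↔ (i.val + 1 = j.val ∨ j.val + 1 = i.val)

/-- `r(P)` for a pseudo-path enumerated by `w`: the number of (internal) vertices
having out-degree 2 or in-degree 2 in the pseudo-path. -/
noncomputable def turnCount {V : Type} (E : V → V → Prop) {m : ℕ} (w : Fin m → V) : ℕ :=
  Set.ncard {i : Fin m | ∃ j k : Fin m, j.val + 1 = i.val ∧ i.val + 1 = k.val ∧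
    ((E (w i) (w j) ∧ E (w i) (w k)) ∨ (E (w j) (w i) ∧ E (w k) (w i)))}

/-- Condition (D1): the underlying graph of `E` is `{K*_n, K_{1,n}, F^(1)_n, F^(2)_n}`-free. -/
def CondD1 {V : Type} (n : ℕ) (E : V → V → Prop) : Prop :=
  ¬ HasInducedCopyG (KStarG n) (SimpleGraph.fromRel E) ∧
  ¬ HasInducedCopyG (StarG n) (SimpleGraph.fromRel E) ∧
  ¬ HasInducedCopyG (F1G n) (SimpleGraph.fromRel E) ∧
  ¬ HasInducedCopyG (F2G n) (SimpleGraph.fromRel E)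

/-- Condition (D'1): the underlying graph of `E` is
`{K*_n, K_{1,n}, F^(1)_n, F^(2)_n, F^(3)_n, F^(4)_n}`-free. -/
def CondD1' {V : Type} (n : ℕ) (E : V → V → Prop) : Prop :=
  CondD1 n E ∧
  ¬ HasInducedCopyG (F3G n) (SimpleGraph.fromRel E) ∧
  ¬ HasInducedCopyG (F4G n) (SimpleGraph.fromRel E)

/-- Condition (D2): `E` is `{D^(1)_n, D^(2)_n, D^(3)_n}`-free. -/
def CondD2 {V : Type} (n : ℕ) (E : V → V → Prop) : Prop :=
  ¬ DigraphHasInducedCopy (D1Rel n) E ∧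
  ¬ DigraphHasInducedCopy (D2Rel n) E ∧
  ¬ DigraphHasInducedCopy (D3Rel n) E

/-- Condition (D3): `r(P) ≤ n` for every induced pseudo-path `P` of `E`. -/
def CondD3 {V : Type} (n : ℕ) (E : V → V → Prop) : Prop :=
  ∀ (m : ℕ) (w : Fin m → V), IsInducedPsPath E w → turnCount E w ≤ n

/-- The Ramsey number `R(a, b)`: the least `R` such that every graph on at least `R`
vertices contains a clique of size `a` or an independent set of size `b`. -/
noncomputable def ramseyNumber (a b : ℕ) : ℕ :=
  sInf {R | ∀ m : ℕ, R ≤ m → ∀ G : SimpleGraph (Fin m),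
    (∃ s : Finset (Fin m), G.IsNClique a s) ∨ (∃ s : Finset (Fin m), Gᶜ.IsNClique b s)}

/-- The independence number of the subgraph of `G` induced by `X`. -/
noncomputable def indepNumOn {V : Type} (G : SimpleGraph V) (X : Set V) : ℕ :=
  sSup {k | ∃ s : Finset V, ↑s ⊆ X ∧ s.card = k ∧ ∀ a ∈ s, ∀ b ∈ s, a ≠ b → ¬ G.Adj a b}

/-- The independence number `α(G)`. -/
noncomputable def indepNum {V : Type} (G : SimpleGraph V) : ℕ := indepNumOn G Set.univ

/-- The neighborhood `N_G(X)` of a set of vertices. -/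
def nbhd {V : Type} (G : SimpleGraph V) (X : Set V) : Set V :=
  {v | v ∉ X ∧ ∃ x ∈ X, G.Adj v x}


namespace DigraphPathCover

/-! ### Ramsey's theorem and the independence number of balls -/

theorem exists_ramsey (a b : ℕ) : ∃ R : ℕ, ∀ (V : Type) (G : SimpleGraph V) (S : Finset V),
    R ≤ S.card →
      (∃ K ⊆ S, K.card = a ∧ ∀ u ∈ K, ∀ v ∈ K, u ≠ v → G.Adj u v) ∨
      (∃ I ⊆ S, I.card = b ∧ ∀ u ∈ I, ∀ v ∈ I, ¬ G.Adj u v) := by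
  classical
  induction a generalizing b with
  | zero => exact ⟨0, fun V G S _ => Or.inl ⟨∅, by simp⟩⟩
  | succ a iha =>
    induction b with
    | zero => exact ⟨0, fun V G S _ => Or.inr ⟨∅, by simp⟩⟩
    | succ b ihb =>
      obtain ⟨R₁, h₁⟩ := iha (b + 1)
      obtain ⟨R₂, h₂⟩ := ihb
      refine ⟨R₁ + R₂ + 1, fun V G S hS => ?_⟩
      obtain ⟨v, hv⟩ : S.Nonempty := Finset.card_pos.mp (by omega)
      have hsplit := Finset.card_filter_add_card_filter_not (s := S.erase v) (fun u => G.Adj v u)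
      rw [Finset.card_erase_of_mem hv] at hsplit
      by_cases hR : R₁ ≤ ((S.erase v).filter (fun u => G.Adj v u)).card
      · rcases h₁ V G _ hR with ⟨K, hKS, hK, hadj⟩ | ⟨I, hIS, hI⟩
        · left
          have hv' : ∀ u ∈ K, u ∈ S ∧ G.Adj v u := fun u hu => by
            have := Finset.mem_filter.mp (hKS hu)
            exact ⟨Finset.mem_of_mem_erase this.1, this.2⟩
          refine ⟨insert v K, ?_, ?_, ?_⟩
          · intro u hu
            rcases Finset.mem_insert.mp hu with rfl | hu
            exacts [hv, (hv' u hu).1]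
          · rw [Finset.card_insert_of_notMem (fun h => G.irrefl (hv' v h).2), hK]
          · intro u hu w hw huw
            rcases Finset.mem_insert.mp hu with rfl | hu' <;>
              rcases Finset.mem_insert.mp hw with rfl | hw'
            exacts [absurd rfl huw, (hv' w hw').2, (hv' u hu').2.symm, hadj u hu' w hw' huw]
        · exact Or.inr ⟨I, fun u hu =>
            Finset.mem_of_mem_erase (Finset.mem_filter.mp (hIS hu)).1, hI⟩
      · have hR' : R₂ ≤ ((S.erase v).filter (fun u => ¬ G.Adj v u)).card := by omega
        rcases h₂ V G _ hR' with ⟨K, hKS, hK⟩ | ⟨I, hIS, hI, hadj⟩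
        · exact Or.inl ⟨K, fun u hu =>
            Finset.mem_of_mem_erase (Finset.mem_filter.mp (hKS hu)).1, hK⟩
        · right
          have hv' : ∀ u ∈ I, u ∈ S ∧ u ≠ v ∧ ¬ G.Adj v u := fun u hu => by
            have := Finset.mem_filter.mp (hIS hu)
            exact ⟨Finset.mem_of_mem_erase this.1, Finset.ne_of_mem_erase this.1, this.2⟩
          refine ⟨insert v I, ?_, ?_, ?_⟩
          · intro u hu
            rcases Finset.mem_insert.mp hu with rfl | hu
            exacts [hv, (hv' u hu).1]
          · rw [Finset.card_insert_of_notMem (fun h => (hv' v h).2.1 rfl), hI]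
          · intro u hu w hw
            rcases Finset.mem_insert.mp hu with rfl | hu' <;>
              rcases Finset.mem_insert.mp hw with rfl | hw'
            exacts [G.irrefl, (hv' w hw').2.2, fun h => (hv' u hu').2.2 h.symm,
              hadj u hu' w hw']

/-- Every independent set of `G` contained in `X` has at most `k` vertices. -/
def IndepBound {V : Type} (G : SimpleGraph V) (X : Set V) (k : ℕ) : Prop :=
  ∀ I : Finset V, (∀ v ∈ I, v ∈ X) → (∀ u ∈ I, ∀ v ∈ I, ¬ G.Adj u v) → I.card ≤ k

theorem starG_adj {n : ℕ} (a b : Unit ⊕ Fin n) :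
    (StarG n).Adj a b ↔ (a.isLeft ∧ b.isRight) ∨ (a.isRight ∧ b.isLeft) := by
  rcases a with a | a <;> rcases b with b | b <;> simp [StarG, SimpleGraph.fromRel_adj]

theorem indepBound_neighbors {V : Type} {G : SimpleGraph V} {n : ℕ}
    (hstar : ¬ HasInducedCopyG (StarG n) G) (x : V) (X : Set V) (hX : ∀ v ∈ X, G.Adj x v) :
    IndepBound G X n := by
  intro I hI hind
  by_contra! hcard
  obtain ⟨J, hJI, hJ⟩ := Finset.exists_subset_card_eq hcard.le
  let e := J.equivFinOfCardEq hJ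
  have hxJ : ∀ i, G.Adj x (e.symm i) := fun i => hX _ (hI _ (hJI (e.symm i).2))
  refine hstar ⟨Sum.elim (fun _ => x) (fun i => (e.symm i : V)), ?_, ?_⟩
  · rintro (a | a) (b | b) h
    · rfl
    · exact absurd h (hxJ b).ne
    · exact absurd h (hxJ a).ne'
    · simpa using h
  · rintro (a | a) (b | b)
    · simp [StarG]
    · simpa [starG_adj] using hxJ b
    · simpa [starG_adj] using (hxJ a).symm
    · simpa [starG_adj] using hind _ (hJI (e.symm a).2) _ (hJI (e.symm b).2)

theorem kStarG_adj {n : ℕ} (a b : Fin n ⊕ Fin n) : (KStarG n).Adj a b ↔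
    match a, b with
    | Sum.inl i, Sum.inl j => i ≠ j
    | Sum.inl i, Sum.inr j => i = j
    | Sum.inr i, Sum.inl j => i = j
    | Sum.inr _, Sum.inr _ => False := by
  rcases a with a | a <;> rcases b with b | b <;>
    simp [KStarG, SimpleGraph.fromRel_adj, eq_comm]

theorem exists_indepBound_expand (n a : ℕ) : ∃ b : ℕ, ∀ (V : Type) (G : SimpleGraph V),
    ¬ HasInducedCopyG (KStarG n) G → ¬ HasInducedCopyG (StarG n) G →
    ∀ X : Set V, IndepBound G X a → IndepBound G {v | v ∈ X ∨ ∃ x ∈ X, G.Adj v x} b := by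
  classical
  obtain ⟨R, hR⟩ := exists_ramsey n (a + 1)
  refine ⟨a + R * n, fun V G hK hstar X hX I hI hind => ?_⟩
  have hsplit := Finset.card_filter_add_card_filter_not (s := I) (fun u => u ∈ X)
  have hin : (I.filter (fun u => u ∈ X)).card ≤ a :=
    hX _ (fun v hv => (Finset.mem_filter.mp hv).2) fun u hu v hv =>
      hind u (Finset.mem_filter.mp hu).1 v (Finset.mem_filter.mp hv).1
  set J := I.filter (fun u => ¬ u ∈ X) with hJ
  suffices J.card ≤ R * n by omega
  have hJX : ∀ v ∈ J, v ∈ I ∧ v ∉ X ∧ ∃ x ∈ X, G.Adj v x := fun v hv => by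
    have := Finset.mem_filter.mp hv
    exact ⟨this.1, this.2, (hI v this.1).resolve_left this.2⟩
  choose! f hf using fun v hv => (hJX v hv).2.2
  -- a minimal subset of `X` dominating `J`
  obtain ⟨D, hD, hmin⟩ := Finset.exists_min_image
    ((J.image f).powerset.filter (fun D => ∀ v ∈ J, ∃ x ∈ D, G.Adj v x)) Finset.card
    ⟨J.image f, by
      simp only [Finset.mem_filter, Finset.mem_powerset, subset_refl, true_and]
      exact fun v hv => ⟨f v, Finset.mem_image_of_mem f hv, (hf v hv).2⟩⟩
  simp only [Finset.mem_filter, Finset.mem_powerset] at hD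
  obtain ⟨hDsub, hDdom⟩ := hD
  have hDX : ∀ x ∈ D, x ∈ X := fun x hx => by
    obtain ⟨v, hv, rfl⟩ := Finset.mem_image.mp (hDsub hx)
    exact (hf v hv).1
  have hpriv : ∀ x ∈ D, ∃ v ∈ J, ∀ y ∈ D, (G.Adj v y ↔ y = x) := by
    intro x hx
    by_contra! hno
    have hdom' : ∀ v ∈ J, ∃ y ∈ D.erase x, G.Adj v y := fun v hv => by
      by_contra! hv'
      obtain ⟨y, hy, hy'⟩ := hno v hv
      obtain ⟨z, hz, hvz⟩ := hDdom v hv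
      have h1 : ∀ w ∈ D, G.Adj v w → w = x := fun w hw hvw => by
        by_contra hne
        exact hv' w (Finset.mem_erase.mpr ⟨hne, hw⟩) hvw
      rcases hy' with ⟨h2, h3⟩ | ⟨h2, rfl⟩
      · exact h3 (h1 y hy h2)
      · exact h2 (h1 z hz hvz ▸ hvz)
    have := hmin (D.erase x) (by
      simp only [Finset.mem_filter, Finset.mem_powerset]
      exact ⟨(Finset.erase_subset x D).trans hDsub, hdom'⟩)
    exact absurd this (not_le.mpr (Finset.card_erase_lt_of_mem hx))
  have hDR : D.card ≤ R := by
    by_contra! hlt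
    rcases hR V G D hlt.le with ⟨K, hKD, hKn, hKadj⟩ | ⟨L, hLD, hLcard, hLind⟩
    · choose! g hg using hpriv
      let e := K.equivFinOfCardEq hKn
      have heD : ∀ i, (e.symm i : V) ∈ D := fun i => hKD (e.symm i).2
      have hgX : ∀ i j, (e.symm i : V) ≠ g (e.symm j) := fun i j h =>
        (hJX _ (hg _ (heD j)).1).2.1 (h ▸ hDX _ (heD i))
      have hga : ∀ i j, G.Adj (e.symm i) (g (e.symm j)) ↔ i = j := fun i j => by
        rw [G.adj_comm, (hg _ (heD j)).2 _ (heD i), Subtype.coe_inj, e.symm.injective.eq_iff]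
      refine hK ⟨Sum.elim (fun i => (e.symm i : V)) (fun i => g (e.symm i)), ?_, ?_⟩
      · rintro (i | i) (j | j) h
        · simpa using h
        · exact absurd h (hgX i j)
        · exact absurd h.symm (hgX j i)
        · have h' : g (e.symm i) = g (e.symm j) := h
          have := (hga i i).2 rfl
          rw [h', hga] at this
          rw [this]
      · rintro (i | i) (j | j) <;> rw [kStarG_adj]
        · exact ⟨fun h hij => h.ne (by simp [hij]), fun hij => hKadj _ (e.symm i).2 _ (e.symm j).2
            (fun h => hij (by simpa using h))⟩
        · exact hga i j
        · exact (G.adj_comm _ _).trans ((hga j i).trans eq_comm)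
        · exact iff_of_false (hind _ (hJX _ (hg _ (heD i)).1).1 _ (hJX _ (hg _ (heD j)).1).1) id
    · have := hX L (fun v hv => hDX v (hLD hv)) hLind
      omega
  calc J.card ≤ (D.biUnion fun x => J.filter fun v => G.Adj x v).card := by
        refine Finset.card_le_card fun v hv => ?_
        obtain ⟨x, hx, hvx⟩ := hDdom v hv
        simp only [Finset.mem_biUnion, Finset.mem_filter]
        exact ⟨x, hx, hv, hvx.symm⟩
    _ ≤ D.card * n := Finset.card_biUnion_le_card_mul _ _ _ fun x _ =>
        indepBound_neighbors hstar x {v | G.Adj x v} (fun _ h => h) _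
          (fun v hv => (Finset.mem_filter.mp hv).2) fun u hu v hv =>
            hind u (hJX u (Finset.mem_filter.mp hu).1).1 v (hJX v (Finset.mem_filter.mp hv).1).1
    _ ≤ R * n := Nat.mul_le_mul_right n hDR

theorem exists_indepBound_ball (n r : ℕ) : ∃ b : ℕ, ∀ (V : Type) (G : SimpleGraph V),
    ¬ HasInducedCopyG (KStarG n) G → ¬ HasInducedCopyG (StarG n) G → G.Connected →
    ∀ v : V, IndepBound G {u | G.dist u v ≤ r} b := by
  induction r with
  | zero =>
    refine ⟨1, fun V G _ _ hconn v I hI _ => Finset.card_le_one.mpr fun a ha b hb => ?_⟩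
    have h : ∀ u ∈ I, u = v := fun u hu => hconn.dist_eq_zero_iff.mp (Nat.le_zero.mp (hI u hu))
    rw [h a ha, h b hb]
  | succ r ih =>
    obtain ⟨a, ha⟩ := ih
    obtain ⟨b, hb⟩ := exists_indepBound_expand n a
    refine ⟨b, fun V G hK hstar hconn v I hI => ?_⟩
    refine hb V G hK hstar _ (ha V G hK hstar hconn v) I fun u hu => ?_
    obtain ⟨p, hp⟩ := hconn.exists_walk_length_eq_dist u v
    have hlen : p.length ≤ r + 1 := hp ▸ hI u hu
    cases p with
    | nil => exact Or.inl (by simp)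
    | cons h q =>
      rw [SimpleGraph.Walk.length_cons] at hlen
      exact Or.inr ⟨_, (SimpleGraph.dist_le q).trans (by omega), h⟩

/-! ### The Gallai–Milgram theorem -/

/-- `S` is obtained by starting new directed paths and extending existing ones at their terminal
vertex, with `T` the set of terminal vertices. -/
inductive PathBuild {V : Type} [DecidableEq V] (E : V → V → Prop) : Finset V → Finset V → Prop
  | empty : PathBuild E ∅ ∅
  | new {S T : Finset V} (w : V) : PathBuild E S T → w ∉ S →
      PathBuild E (insert w S) (insert w T)
  | extend {S T : Finset V} (v w : V) : PathBuild E S T → v ∈ T → w ∉ S → E v w →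
      PathBuild E (insert w S) (insert w (T.erase v))

namespace PathBuild

variable {V : Type} [DecidableEq V] {E : V → V → Prop} {S T : Finset V}

theorem subset (h : PathBuild E S T) : T ⊆ S := by
  induction h with
  | empty => exact subset_rfl
  | new w _ _ ih => exact Finset.insert_subset_insert _ ih
  | extend v w _ _ _ _ ih =>
    exact Finset.insert_subset_insert _ ((Finset.erase_subset _ _).trans ih)

theorem of_singletons (S : Finset V) : PathBuild E S S := by
  induction S using Finset.induction_on with
  | empty => exact .empty
  | insert w S hw ih => exact .new w ih hw

/-- Deleting a terminal vertex. -/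
theorem erase (h : PathBuild E S T) {x : V} (hx : x ∈ T) :
    PathBuild E (S.erase x) (T.erase x) ∨
      ∃ v ∈ S, v ∉ T ∧ E v x ∧ PathBuild E (S.erase x) (insert v (T.erase x)) := by
  induction h with
  | empty => simp at hx
  | @new S T w h hw ih =>
    have hwT : w ∉ T := fun hw' => hw (h.subset hw')
    by_cases hxw : x = w
    · subst hxw
      left
      rwa [Finset.erase_insert hw, Finset.erase_insert hwT]
    · have hxT : x ∈ T := (Finset.mem_insert.mp hx).resolve_left hxw
      have hw' : w ∉ S.erase x := fun h => hw (Finset.mem_of_mem_erase h)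
      rw [Finset.erase_insert_of_ne (Ne.symm hxw), Finset.erase_insert_of_ne (Ne.symm hxw)]
      rcases ih hxT with ih | ⟨v, hvS, hvT, hvx, ih⟩
      · exact Or.inl (.new w ih hw')
      · refine Or.inr ⟨v, Finset.mem_insert_of_mem hvS, ?_, hvx, ?_⟩
        · rw [Finset.mem_insert, not_or]
          exact ⟨fun h => hw (h ▸ hvS), hvT⟩
        · rw [Finset.insert_comm]
          exact .new w ih hw'
  | @extend S T u w h hu hw huw ih =>
    have hwT : w ∉ T := fun hw' => hw (h.subset hw')
    by_cases hxw : x = w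
    · subst hxw
      right
      refine ⟨u, Finset.mem_insert_of_mem (h.subset hu), ?_, huw, ?_⟩
      · rw [Finset.mem_insert, not_or]
        exact ⟨fun h => hwT (h ▸ hu), Finset.notMem_erase u T⟩
      · rw [Finset.erase_insert hw, Finset.erase_insert (fun h => hwT (Finset.mem_of_mem_erase h)),
          Finset.insert_erase hu]
        exact h
    · have hxT' : x ∈ T.erase u := (Finset.mem_insert.mp hx).resolve_left hxw
      obtain ⟨hxu, hxT⟩ := Finset.mem_erase.mp hxT'
      have hw' : w ∉ S.erase x := fun h => hw (Finset.mem_of_mem_erase h)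
      rw [Finset.erase_insert_of_ne (Ne.symm hxw), Finset.erase_insert_of_ne (Ne.symm hxw)]
      rcases ih hxT with ih | ⟨v, hvS, hvT, hvx, ih⟩
      · left
        rw [Finset.erase_right_comm]
        exact .extend u w ih (Finset.mem_erase.mpr ⟨Ne.symm hxu, hu⟩) hw' huw
      · refine Or.inr ⟨v, Finset.mem_insert_of_mem hvS, ?_, hvx, ?_⟩
        · rw [Finset.mem_insert, not_or]
          exact ⟨fun h => hw (h ▸ hvS), fun h => hvT (Finset.mem_of_mem_erase h)⟩
        · have hvu : v ≠ u := fun h => hvT (h ▸ hu)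
          have := PathBuild.extend u w ih
            (Finset.mem_insert_of_mem (Finset.mem_erase.mpr ⟨Ne.symm hxu, hu⟩)) hw' huw
          rwa [Finset.erase_insert_of_ne hvu, Finset.erase_right_comm,
            Finset.insert_comm] at this

/-- If the terminal set cannot be shrunk, there is an independent set of the same size. -/
theorem exists_indep (h : PathBuild E S T) (hirr : ∀ v, ¬ E v v)
    (hmin : ∀ T', PathBuild E S T' → ¬ T' ⊂ T) :
    ∃ I ⊆ S, I.card = T.card ∧ ∀ u ∈ I, ∀ v ∈ I, ¬ E u v := by
  induction hk : S.card generalizing S T with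
  | zero =>
    obtain rfl := Finset.card_eq_zero.mp hk
    obtain rfl := Finset.subset_empty.mp h.subset
    exact ⟨∅, by simp⟩
  | succ k ih =>
    by_cases hind : ∀ u ∈ T, ∀ v ∈ T, ¬ E u v
    · exact ⟨T, h.subset, rfl, hind⟩
    push Not at hind
    obtain ⟨u, hu, x, hx, hux⟩ := hind
    have hne : u ≠ x := fun h => hirr x (h ▸ hux)
    have hxS := h.subset hx
    have hins := Finset.insert_erase hxS
    have huT : u ∈ T.erase x := Finset.mem_erase.mpr ⟨hne, hu⟩
    -- a terminal set avoiding `u` would be smaller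
    have hsmaller : ∀ T', PathBuild E S T' → T' ⊆ T → u ∉ T' → False := fun T' h' hsub hu' =>
      hmin T' h' ⟨hsub, fun hle => hu' (hle hu)⟩
    have hext : ∀ T', PathBuild E (S.erase x) T' → u ∈ T' → T' ⊆ T → False := by
      intro T' h' hu' hsub
      have := PathBuild.extend u x h' hu' (Finset.notMem_erase x S) hux
      rw [hins] at this
      refine hsmaller _ this ?_ ?_
      · exact Finset.insert_subset hx ((Finset.erase_subset _ _).trans hsub)
      · rw [Finset.mem_insert, not_or]
        exact ⟨hne, Finset.notMem_erase _ _⟩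
    rcases h.erase hx with h' | ⟨v, hvS, hvT, hvx, h'⟩
    · exact (hext _ h' huT (Finset.erase_subset _ _)).elim
    have hvT' : v ∉ T.erase x := fun h => hvT (Finset.mem_of_mem_erase h)
    obtain ⟨I, hIS, hI, hIind⟩ := ih h' (by
      intro T' hT' hss
      have hxT' : x ∉ T' := fun h => Finset.notMem_erase x S (hT'.subset h)
      by_cases hv : v ∈ T'
      · have hb := PathBuild.extend v x hT' hv (Finset.notMem_erase x S) hvx
        rw [hins] at hb
        refine hmin _ hb ?_
        obtain ⟨z, hz, hzT'⟩ := Finset.exists_of_ssubset hss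
        have hzv : z ≠ v := fun h => hzT' (h ▸ hv)
        have hzT := (Finset.mem_insert.mp hz).resolve_left hzv
        refine ⟨?_, fun hle => ?_⟩
        · intro y hy
          rcases Finset.mem_insert.mp hy with rfl | hy
          · exact hx
          · obtain ⟨hyv, hy⟩ := Finset.mem_erase.mp hy
            exact Finset.mem_of_mem_erase ((Finset.mem_insert.mp (hss.1 hy)).resolve_left hyv)
        · have := hle (Finset.mem_of_mem_erase hzT)
          rcases Finset.mem_insert.mp this with rfl | this
          · exact Finset.notMem_erase _ _ hzT
          · exact hzT' (Finset.mem_of_mem_erase this)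
      · have hsub : T' ⊆ T := fun y hy =>
          Finset.mem_of_mem_erase ((Finset.mem_insert.mp (hss.1 hy)).resolve_left
            fun h => hv (h ▸ hy))
        by_cases huT' : u ∈ T'
        · exact hext T' hT' huT' hsub
        · have hb := PathBuild.new x hT' (Finset.notMem_erase x S)
          rw [hins] at hb
          refine hsmaller _ hb (Finset.insert_subset hx hsub) ?_
          rw [Finset.mem_insert, not_or]
          exact ⟨hne, huT'⟩) (by rw [Finset.card_erase_of_mem hxS]; omega)
    refine ⟨I, hIS.trans (Finset.erase_subset _ _), ?_, hIind⟩
    rw [hI, Finset.card_insert_of_notMem hvT', Finset.card_erase_of_mem hx]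
    have := Finset.card_pos.mpr ⟨x, hx⟩
    omega

theorem exists_lists (h : PathBuild E S T) : ∃ f : V → List V,
    (∀ t ∈ T, (∃ l, f t = l ++ [t]) ∧ (f t).Nodup ∧ (f t).IsChain E ∧ ∀ v ∈ f t, v ∈ S) ∧
    ∀ v ∈ S, ∃ t ∈ T, v ∈ f t := by
  induction h with
  | empty => exact ⟨fun _ => [], by simp⟩
  | @new S T w h hw ih =>
    obtain ⟨f, hf, hcov⟩ := ih
    have hne : ∀ t ∈ T, t ≠ w := fun t ht e => hw (e ▸ h.subset ht)
    refine ⟨Function.update f w [w], ?_, ?_⟩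
    · intro t ht
      rcases Finset.mem_insert.mp ht with rfl | ht
      · simp
      · rw [Function.update_of_ne (hne t ht)]
        obtain ⟨h1, h2, h3, h4⟩ := hf t ht
        exact ⟨h1, h2, h3, fun v hv => Finset.mem_insert_of_mem (h4 v hv)⟩
    · intro v hv
      rcases Finset.mem_insert.mp hv with rfl | hv
      · exact ⟨v, Finset.mem_insert_self _ _, by simp⟩
      · obtain ⟨t, ht, hvt⟩ := hcov v hv
        exact ⟨t, Finset.mem_insert_of_mem ht, by rwa [Function.update_of_ne (hne t ht)]⟩
  | @extend S T u w h hu hw huw ih =>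
    obtain ⟨f, hf, hcov⟩ := ih
    have hne : ∀ t ∈ T, t ≠ w := fun t ht e => hw (e ▸ h.subset ht)
    refine ⟨Function.update f w (f u ++ [w]), ?_, ?_⟩
    · intro t ht
      rcases Finset.mem_insert.mp ht with rfl | ht
      · obtain ⟨⟨l, hl⟩, h2, h3, h4⟩ := hf u hu
        rw [Function.update_self]
        refine ⟨⟨_, rfl⟩, ?_, ?_, ?_⟩
        · rw [List.nodup_append]
          refine ⟨h2, by simp, fun a ha b hb hab => ?_⟩
          rw [List.mem_singleton] at hb
          exact hw (hb ▸ hab ▸ h4 a ha)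
        · rw [List.isChain_append]
          refine ⟨h3, by simp, ?_⟩
          simpa [hl] using huw
        · intro v hv
          rcases List.mem_append.mp hv with hv | hv
          · exact Finset.mem_insert_of_mem (h4 v hv)
          · rw [List.mem_singleton.mp hv]
            exact Finset.mem_insert_self _ _
      · have ht' := Finset.mem_of_mem_erase ht
        rw [Function.update_of_ne (hne t ht')]
        obtain ⟨h1, h2, h3, h4⟩ := hf t ht'
        exact ⟨h1, h2, h3, fun v hv => Finset.mem_insert_of_mem (h4 v hv)⟩
    · intro v hv
      rcases Finset.mem_insert.mp hv with rfl | hv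
      · exact ⟨v, Finset.mem_insert_self _ _, by simp⟩
      · obtain ⟨t, ht, hvt⟩ := hcov v hv
        by_cases htu : t = u
        · subst htu
          exact ⟨w, Finset.mem_insert_self _ _, by simp [hvt]⟩
        · exact ⟨t, Finset.mem_insert_of_mem (Finset.mem_erase.mpr ⟨htu, ht⟩),
            by rwa [Function.update_of_ne (hne t ht)]⟩

end PathBuild

theorem adj_iff {V : Type} {E : V → V → Prop} (hE : ∀ u v, E u v → ¬ E v u) {u v : V} :
    (SimpleGraph.fromRel E).Adj u v ↔ E u v ∨ E v u := by
  rw [SimpleGraph.fromRel_adj, and_iff_right_iff_imp]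
  rintro (h | h) rfl <;> exact hE _ _ h h

/-- A weak form of the **Gallai–Milgram theorem**: a set with independence number at most `k` is
covered by `k` (possibly empty) directed paths inside the set. -/
theorem exists_lists_of_indepBound {V : Type} [Fintype V] {E : V → V → Prop}
    (hE : ∀ u v, E u v → ¬ E v u) {X : Set V} {k : ℕ}
    (hX : IndepBound (SimpleGraph.fromRel E) X k) :
    ∃ f : Fin k → List V, (∀ i, (f i).Nodup ∧ (f i).IsChain E ∧ ∀ v ∈ f i, v ∈ X) ∧
      ∀ v ∈ X, ∃ i, v ∈ f i := by
  classical
  obtain ⟨T, hT, hmin⟩ := Finset.exists_min_image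
    (Finset.univ.filter fun T : Finset V => PathBuild E X.toFinset T) Finset.card
    ⟨X.toFinset, by simpa using PathBuild.of_singletons _⟩
  have hT' := (Finset.mem_filter.mp hT).2
  obtain ⟨I, hIX, hI, hind⟩ := hT'.exists_indep (fun v h => hE v v h h) fun T' h' hss =>
    absurd (hmin T' (by simpa using h')) (not_le.mpr (Finset.card_lt_card hss))
  have hTk : T.card ≤ k := hI ▸ hX I (fun v hv => by simpa using hIX hv) fun u hu v hv h =>
    ((adj_iff hE).mp h).elim (hind u hu v hv) (hind v hv u hu)
  obtain ⟨f, hf, hcov⟩ := hT'.exists_lists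
  let e := T.equivFin
  refine ⟨fun i => if h : i.val < T.card then f (e.symm ⟨i.val, h⟩) else [], fun i => ?_,
    fun v hv => ?_⟩
  · by_cases h : i.val < T.card
    · simp only [h, dite_true]
      obtain ⟨-, h2, h3, h4⟩ := hf _ (e.symm ⟨i.val, h⟩).2
      exact ⟨h2, h3, fun v hv => by simpa using h4 v hv⟩
    · simp [h]
  · obtain ⟨t, ht, hvt⟩ := hcov v (by simpa using hv)
    refine ⟨⟨(e ⟨t, ht⟩).val, (e ⟨t, ht⟩).2.trans_le hTk⟩, ?_⟩
    simpa using hvt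

/-! ### Path covers of vertex sets -/

/-- `S` is covered by at most `k` directed paths of `E`. -/
def PathCovered {V : Type} (E : V → V → Prop) (S : Set V) (k : ℕ) : Prop :=
  ∃ P : Finset (List V), P.card ≤ k ∧ (∀ l ∈ P, IsDirPathList E l) ∧ ∀ v ∈ S, ∃ l ∈ P, v ∈ l

namespace PathCovered

variable {V : Type} {E : V → V → Prop}

theorem pcOn_le {k : ℕ} (h : PathCovered E Set.univ k) : pcOn E Set.univ ≤ k := by
  obtain ⟨P, hP, hpath, hcov⟩ := h
  refine le_trans (Nat.sInf_le ?_) hP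
  exact ⟨P, rfl, fun l hl => ⟨hpath l hl, fun _ _ => trivial⟩, hcov⟩

theorem mono {S S' : Set V} {k k' : ℕ} (h : PathCovered E S k) (hS : S' ⊆ S) (hk : k ≤ k') :
    PathCovered E S' k' := by
  obtain ⟨P, hP, hpath, hcov⟩ := h
  exact ⟨P, hP.trans hk, hpath, fun v hv => hcov v (hS hv)⟩

theorem union {S S' : Set V} {k k' : ℕ} (h : PathCovered E S k) (h' : PathCovered E S' k') :
    PathCovered E (S ∪ S') (k + k') := by
  classical
  obtain ⟨P, hP, hpath, hcov⟩ := h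
  obtain ⟨P', hP', hpath', hcov'⟩ := h'
  refine ⟨P ∪ P', (Finset.card_union_le P P').trans (by omega), fun l hl => ?_, fun v hv => ?_⟩
  · exact (Finset.mem_union.mp hl).elim (hpath l) (hpath' l)
  · rcases hv with hv | hv
    · obtain ⟨l, hl, hvl⟩ := hcov v hv
      exact ⟨l, Finset.mem_union_left _ hl, hvl⟩
    · obtain ⟨l, hl, hvl⟩ := hcov' v hv
      exact ⟨l, Finset.mem_union_right _ hl, hvl⟩

theorem biUnion {ι : Type} (T : Finset ι) {S : ι → Set V} {k : ℕ}
    (h : ∀ t ∈ T, PathCovered E (S t) k) : PathCovered E {v | ∃ t ∈ T, v ∈ S t} (T.card * k) := by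
  classical
  choose! P hP hpath hcov using h
  refine ⟨T.biUnion P, Finset.card_biUnion_le_card_mul _ _ _ hP, fun l hl => ?_, ?_⟩
  · obtain ⟨t, ht, hl⟩ := Finset.mem_biUnion.mp hl
    exact hpath t ht l hl
  · rintro v ⟨t, ht, hv⟩
    obtain ⟨l, hl, hvl⟩ := hcov t ht v hv
    exact ⟨l, Finset.mem_biUnion.mpr ⟨t, ht, hl⟩, hvl⟩

theorem of_family {ι : Type} [Fintype ι] (f : ι → List V)
    (hf : ∀ i, (f i).Nodup ∧ (f i).IsChain E) :
    PathCovered E {v | ∃ i, v ∈ f i} (Fintype.card ι) := by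
  classical
  refine ⟨(Finset.univ.image f).filter (· ≠ []),
    (Finset.card_filter_le _ _).trans Finset.card_image_le, fun l hl => ?_, ?_⟩
  · obtain ⟨hl, hne⟩ := Finset.mem_filter.mp hl
    obtain ⟨i, -, rfl⟩ := Finset.mem_image.mp hl
    exact ⟨hne, hf i⟩
  · rintro v ⟨i, hv⟩
    exact ⟨f i, Finset.mem_filter.mpr ⟨Finset.mem_image_of_mem f (Finset.mem_univ i),
      List.ne_nil_of_mem hv⟩, hv⟩

theorem of_indepBound [Fintype V] (hE : ∀ u v, E u v → ¬ E v u) {X : Set V} {k : ℕ}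
    (hX : IndepBound (SimpleGraph.fromRel E) X k) : PathCovered E X k := by
  obtain ⟨f, hf, hcov⟩ := exists_lists_of_indepBound hE hX
  exact (of_family f fun i => ⟨(hf i).1, (hf i).2.1⟩).mono (fun v hv => hcov v hv) (by simp)

end PathCovered

theorem isChain_map_range' {V : Type} {E : V → V → Prop} {q : ℕ → V} {L : ℕ}
    (harc : ∀ k < L, E (q k) (q (k + 1))) {j t : ℕ} (hjt : j + t ≤ L + 1) :
    ((List.range' j t).map q).IsChain E := by
  rw [List.isChain_iff_getElem]
  intro i hi
  rw [List.length_map, List.length_range'] at hi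
  simpa [add_assoc] using harc (j + i) (by omega)

theorem nodup_map_range' {V : Type} {q : ℕ → V} {L : ℕ}
    (hinj : ∀ a ≤ L, ∀ b ≤ L, q a = q b → a = b) {j t : ℕ} (hjt : j + t ≤ L + 1) :
    ((List.range' j t).map q).Nodup := by
  refine List.Nodup.map_on (fun a ha b hb h => ?_) List.nodup_range'
  rw [List.mem_range'_1] at ha hb
  exact hinj a (by omega) b (by omega) h

/-- Sets `X i` of detours, each decomposed into directed paths, can be threaded into a directed
path `q 0 → q 1 → ⋯ → q L`, using every fourth index. -/
theorem exists_threaded_path {V : Type} {E : V → V → Prop} {q : ℕ → V} {L : ℕ}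
    (hinj : ∀ a ≤ L, ∀ b ≤ L, q a = q b → a = b) (harc : ∀ k < L, E (q k) (q (k + 1)))
    (X : ℕ → Set V) (hdisj : ∀ a b, ∀ x ∈ X a, x ∈ X b → a = b)
    (hXq : ∀ a, ∀ x ∈ X a, ∀ k ≤ L, x ≠ q k)
    (hX : ∀ a, ∀ x ∈ X a, E (q a) x ∧ ∃ j, a < j ∧ j ≤ a + 3 ∧ E x (q j))
    (A : ℕ → List V)
    (hA : ∀ a, (A a).Nodup ∧ (A a).IsChain E ∧ ∀ v ∈ A a, v ∈ X a) (i : ℕ) (hi : i ≤ L) :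
    ∃ l : List V, (l ++ [q i]).Nodup ∧ (l ++ [q i]).IsChain E ∧
      (∀ v ∈ l, (∃ k < i, v = q k) ∨ ∃ a < i, v ∈ X a) ∧
      ∀ a < i, a % 4 = i % 4 → ∀ v ∈ A a, v ∈ l := by
  induction i using Nat.strong_induction_on with
  | _ i ih =>
  rcases Nat.lt_or_ge i 4 with hi4 | hi4
  · refine ⟨[], by simp, by simp, by simp, fun a ha hmod => ?_⟩
    omega
  obtain ⟨b, rfl⟩ := Nat.exists_eq_add_of_le' hi4
  obtain ⟨l, hnd, hch, hmem, hcov⟩ := ih b (by omega) (by omega)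
  obtain ⟨hAnd, hAch, hAX⟩ := hA b
  -- the index at which the path `q` is resumed after the detour `A b`
  obtain ⟨j, hbj, hjb, hlast⟩ : ∃ j, b < j ∧ j ≤ b + 3 ∧
      ∀ x ∈ ([q b] ++ A b).getLast?, E x (q j) := by
    rcases List.eq_nil_or_concat (A b) with h | ⟨l', x, h⟩
    · exact ⟨b + 1, by omega, by omega, by simpa [h] using harc b (by omega)⟩
    · obtain ⟨-, j, h1, h2, h3⟩ := hX b x (hAX x (by simp [h]))
      refine ⟨j, h1, h2, fun y hy => ?_⟩
      rw [h, List.concat_eq_append, ← List.append_assoc, List.getLast?_concat,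
        Option.mem_some_iff] at hy
      exact hy ▸ h3
  obtain ⟨t, ht⟩ : ∃ t, b + 4 = j + t := ⟨b + 4 - j, by omega⟩
  have hrange : (List.range' j t).map q ++ [q (b + 4)] = (List.range' j (t + 1)).map q := by
    rw [List.range'_1_concat, List.map_append, ht]; rfl
  have hmemR : ∀ v, v ∈ (List.range' j (t + 1)).map q ↔ ∃ k, j ≤ k ∧ k ≤ b + 4 ∧ v = q k := by
    intro v
    simp only [List.mem_map, List.mem_range'_1]
    exact ⟨fun ⟨k, hk, hv⟩ => ⟨k, hk.1, by omega, hv.symm⟩,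
      fun ⟨k, h1, h2, hv⟩ => ⟨k, by omega, hv.symm⟩⟩
  have hfirst : ∀ v ∈ l ++ [q b], (∃ k ≤ b, v = q k) ∨ ∃ a < b, v ∈ X a := by
    intro v hv
    rcases List.mem_append.mp hv with hv | hv
    · exact (hmem v hv).imp_left fun ⟨k, hk, h⟩ => ⟨k, hk.le, h⟩
    · exact Or.inl ⟨b, le_rfl, List.mem_singleton.mp hv⟩
  refine ⟨l ++ [q b] ++ A b ++ (List.range' j t).map q, ?_, ?_, ?_, ?_⟩
  · rw [List.append_assoc, hrange]
    refine List.nodup_append.mpr ⟨List.nodup_append.mpr ⟨hnd, hAnd, ?_⟩,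
      nodup_map_range' hinj (by omega), ?_⟩
    · rintro v hv w hw rfl
      rcases hfirst v hv with ⟨k, hk, h⟩ | ⟨a, ha, h⟩
      · exact hXq b v (hAX v hw) k (by omega) h
      · exact ha.ne (hdisj a b v h (hAX v hw))
    · rintro v hv w hw rfl
      obtain ⟨k, hk1, hk2, rfl⟩ := (hmemR v).mp hw
      rcases List.mem_append.mp hv with hv | hv
      · rcases hfirst _ hv with ⟨k', hk', h⟩ | ⟨a, ha, h⟩
        · have := hinj k (by omega) k' (by omega) h
          omega
        · exact hXq a _ h k (by omega) rfl
      · exact hXq b _ (hAX _ hv) k (by omega) rfl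
  · rw [List.append_assoc, hrange, List.isChain_append]
    refine ⟨List.isChain_append.mpr ⟨hch, hAch, ?_⟩, isChain_map_range' harc (by omega), ?_⟩
    · intro x hx y hy
      obtain rfl : q b = x := by simpa using hx
      exact (hX b y (hAX y (List.mem_of_mem_head? hy))).1
    · intro x hx y hy
      rw [List.append_assoc, List.getLast?_append_of_ne_nil _ (by simp)] at hx
      obtain rfl : q j = y := by simpa [List.range'_succ] using hy
      exact hlast x hx
  · intro v hv
    rcases List.mem_append.mp hv with hv | hv
    · rcases List.mem_append.mp hv with hv | hv
      · rcases hfirst v hv with ⟨k, hk, h⟩ | ⟨a, ha, h⟩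
        · exact Or.inl ⟨k, by omega, h⟩
        · exact Or.inr ⟨a, by omega, h⟩
      · exact Or.inr ⟨b, by omega, hAX v hv⟩
    · obtain ⟨k, hk, rfl⟩ := List.mem_map.mp hv
      rw [List.mem_range'_1] at hk
      exact Or.inl ⟨k, by omega, rfl⟩
  · intro a ha hmod v hv
    rcases Nat.lt_or_ge a b with hab | hab
    · have := hcov a hab (by omega) v hv
      simp [this]
    · obtain rfl : a = b := by omega
      simp [hv]

theorem PathCovered.of_detours {V : Type} [Fintype V] {E : V → V → Prop}
    (hE : ∀ u v, E u v → ¬ E v u) {q : ℕ → V} {L d : ℕ}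
    (hinj : ∀ a ≤ L, ∀ b ≤ L, q a = q b → a = b) (harc : ∀ k < L, E (q k) (q (k + 1)))
    (hα : ∀ v, IndepBound (SimpleGraph.fromRel E) {x | E v x} d) :
    PathCovered E {v | (∃ k ≤ L, v = q k) ∨ ((∀ k ≤ L, v ≠ q k) ∧
      ∃ i j, i < j ∧ j ≤ i + 3 ∧ j ≤ L ∧ E (q i) v ∧ E v (q j))} (1 + 4 * d) := by
  have hpath : PathCovered E {v | ∃ k ≤ L, v = q k} 1 := by
    refine (PathCovered.of_family (fun _ : Unit => (List.range' 0 (L + 1)).map q) fun _ =>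
      ⟨nodup_map_range' hinj (by omega), isChain_map_range' harc (by omega)⟩).mono ?_ (by simp)
    rintro v ⟨k, hk, rfl⟩
    exact ⟨(), List.mem_map.mpr ⟨k, List.mem_range'_1.mpr (by omega), rfl⟩⟩
  refine (hpath.union (S' := {v | (∀ k ≤ L, v ≠ q k) ∧
      ∃ i j, i < j ∧ j ≤ i + 3 ∧ j ≤ L ∧ E (q i) v ∧ E v (q j)}) ?_).mono (fun v hv => hv) le_rfl
  set Y := {v | (∀ k ≤ L, v ≠ q k) ∧
      ∃ i j, i < j ∧ j ≤ i + 3 ∧ j ≤ L ∧ E (q i) v ∧ E v (q j)} with hY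
  choose! f g hfg using fun v (hv : v ∈ Y) => hv.2
  let X : ℕ → Set V := fun a => {v | v ∈ Y ∧ f v = a}
  have hXα : ∀ a, IndepBound (SimpleGraph.fromRel E) (X a) d := fun a I hI =>
    hα (q a) I fun v hv => by
      have := hfg v (hI v hv).1
      rw [(hI v hv).2] at this
      exact this.2.2.2.1
  choose A hA hAcov using fun a => exists_lists_of_indepBound hE (hXα a)
  have hX : ∀ a, ∀ x ∈ X a, E (q a) x ∧ ∃ j, a < j ∧ j ≤ a + 3 ∧ E x (q j) := by
    rintro a x ⟨hx, rfl⟩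
    obtain ⟨h1, h2, -, h4, h5⟩ := hfg x hx
    exact ⟨h4, g x, h1, h2, h5⟩
  have hXq : ∀ a, ∀ x ∈ X a, ∀ k ≤ L, x ≠ q k := fun a x hx => hx.1.1
  have hdisj : ∀ a b, ∀ x ∈ X a, x ∈ X b → a = b := fun a b x ha hb => ha.2.symm.trans hb.2
  choose l hnd hch hmem hcov using fun (s : Fin 4) (c : Fin d) =>
    exists_threaded_path hinj harc X hdisj hXq hX (fun a => A a c) (fun a => hA a c)
      (L - s.val) (by omega)
  refine (PathCovered.of_family (fun sc : Fin 4 × Fin d =>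
    (l sc.1 sc.2 ++ [q (L - sc.1.val)]) ++ A (L - sc.1.val) sc.2) ?_).mono ?_ (by simp)
  · rintro ⟨s, c⟩
    obtain ⟨h1, h2, h3⟩ := hA (L - s.val) c
    refine ⟨List.nodup_append.mpr ⟨hnd s c, h1, ?_⟩, List.isChain_append.mpr ⟨hch s c, h2, ?_⟩⟩
    · rintro v hv w hw rfl
      rcases List.mem_append.mp hv with hv | hv
      · rcases hmem s c v hv with ⟨k, hk, rfl⟩ | ⟨a, ha, h⟩
        · exact hXq _ _ (h3 _ hw) k (by omega) rfl
        · exact ha.ne (hdisj _ _ v h (h3 v hw))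
      · exact hXq _ _ (h3 v hw) _ (by omega) (List.mem_singleton.mp hv)
    · intro x hx y hy
      obtain rfl : q (L - s.val) = x := by simpa using hx
      exact (hX _ y (h3 y (List.mem_of_mem_head? hy))).1
  · intro v hv
    have hfL : f v ≤ L := by
      obtain ⟨h1, -, h3, -⟩ := hfg v hv
      omega
    obtain ⟨c, hc⟩ := hAcov (f v) v ⟨hv, rfl⟩
    refine ⟨⟨⟨(L - f v) % 4, Nat.mod_lt _ (by omega)⟩, c⟩, ?_⟩
    simp only [List.mem_append]
    rcases Nat.lt_or_ge (f v) (L - (L - f v) % 4) with h | h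
    · exact Or.inl (Or.inl (hcov _ c (f v) h (by dsimp only; omega) v hc))
    · right
      rwa [show L - (L - f v) % 4 = f v by omega]

/-! ### Induced paths and the forbidden configurations -/

/-- `y 0, …, y (n - 1)` enumerates an induced path of `G`. -/
def IndPath {V : Type} (G : SimpleGraph V) (y : ℕ → V) (n : ℕ) : Prop :=
  (∀ a < n, ∀ b < n, y a = y b → a = b) ∧
    ∀ a < n, ∀ b < n, (G.Adj (y a) (y b) ↔ a + 1 = b ∨ b + 1 = a)

/-- The sequence `x, y 0, y 1, …`. -/
def consSeq {V : Type} (x : V) (y : ℕ → V) : ℕ → V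
  | 0 => x
  | k + 1 => y k

section Configurations

variable {V : Type} {G : SimpleGraph V} {n m : ℕ} {y z : ℕ → V} {c d : V}

namespace IndPath

theorem shift (h : IndPath G y m) {a : ℕ} (ha : a + n ≤ m) : IndPath G (fun k => y (a + k)) n :=
  ⟨fun i hi j hj e => by have := h.1 _ (by omega) _ (by omega) e; omega,
    fun i hi j hj => (h.2 _ (by omega) _ (by omega)).trans (by omega)⟩

theorem backward (h : IndPath G y m) {a : ℕ} (ha : a < m) (hn : n ≤ a + 1) :
    IndPath G (fun k => y (a - k)) n :=
  ⟨fun i hi j hj e => by have := h.1 _ (by omega) _ (by omega) e; omega,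
    fun i hi j hj => (h.2 _ (by omega) _ (by omega)).trans (by omega)⟩

theorem mono (h : IndPath G y m) (hn : n ≤ m) : IndPath G y n :=
  ⟨fun i hi j hj => h.1 i (by omega) j (by omega), fun i hi j hj => h.2 i (by omega) j (by omega)⟩

theorem cons (h : IndPath G y n) {x : V} (hne : ∀ k < n, x ≠ y k)
    (hx : ∀ k < n, (G.Adj x (y k) ↔ k = 0)) : IndPath G (consSeq x y) (n + 1) := by
  constructor
  · rintro (_ | i) hi (_ | j) hj e
    · rfl
    · exact absurd e (hne j (by omega))
    · exact absurd e.symm (hne i (by omega))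
    · rw [h.1 i (by omega) j (by omega) e]
  · rintro (_ | i) hi (_ | j) hj
    · simp [consSeq]
    · exact (hx j (by omega)).trans (by omega)
    · exact (G.adj_comm _ _).trans ((hx i (by omega)).trans (by omega))
    · exact (h.2 i (by omega) j (by omega)).trans (by omega)

end IndPath

/-- Two induced paths `y` and `z`, whose only common edge, if any, is `y 0 z 0`, and a vertex `c`
adjacent exactly to their first vertices. -/
structure Fork (G : SimpleGraph V) (n : ℕ) (c : V) (y z : ℕ → V) : Prop where
  two_le : 2 ≤ n
  path_y : IndPath G y n
  path_z : IndPath G z n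
  adj_y : ∀ k < n, (G.Adj c (y k) ↔ k = 0)
  adj_z : ∀ k < n, (G.Adj c (z k) ↔ k = 0)
  cross : ∀ k < n, ∀ l < n, G.Adj (y k) (z l) → k = 0 ∧ l = 0

namespace Fork

theorem symm (h : Fork G n c y z) : Fork G n c z y :=
  ⟨h.two_le, h.path_z, h.path_y, h.adj_z, h.adj_y, fun k hk l hl e =>
    (h.cross l hl k hk e.symm).symm⟩

theorem y_ne_z (h : Fork G n c y z) {k l : ℕ} (hk : k < n) (hl : l < n) : y k ≠ z l := by
  have hn := h.two_le
  intro e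
  rcases Nat.eq_zero_or_pos k with rfl | hk0
  · have := (h.path_y.2 1 (by omega) 0 hk).2 (by omega)
    rw [e] at this
    exact absurd (h.cross _ (by omega) _ hl this).1 (by omega)
  · rcases Nat.eq_zero_or_pos l with rfl | hl0
    · have := (h.adj_z 0 hl).2 rfl
      rw [← e, h.adj_y k hk] at this
      omega
    · have := (h.path_y.2 (k - 1) (by omega) k hk).2 (by omega)
      rw [e] at this
      exact absurd (h.cross _ (by omega) _ hl this).2 (by omega)

theorem c_ne_y (h : Fork G n c y z) {k : ℕ} (hk : k < n) : c ≠ y k := by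
  have hn := h.two_le
  intro e
  rcases Nat.eq_zero_or_pos k with rfl | hk0
  · exact ((h.adj_y 0 hk).2 rfl).ne e
  · have := (h.adj_z 0 (by omega)).2 rfl
    rw [e] at this
    exact absurd (h.cross k hk 0 (by omega) this).1 (by omega)

theorem d_ne_y (h : Fork G n c y z) (hcd : G.Adj c d) (hdy : ∀ k < n, ¬ G.Adj d (y k)) {k : ℕ}
    (hk : k < n) : d ≠ y k := by
  have hn := h.two_le
  intro e
  rw [e, h.adj_y k hk] at hcd
  subst hcd
  exact hdy 1 (by omega) (e ▸ (h.path_y.2 0 hk 1 (by omega)).2 (by omega))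

theorem injective (h : Fork G n c y z) (hcd : G.Adj c d) (hdy : ∀ k < n, ¬ G.Adj d (y k))
    (hdz : ∀ k < n, ¬ G.Adj d (z k)) : Function.Injective
      (Sum.elim ![c, d] (Sum.elim (fun k : Fin n => y k) (fun k : Fin n => z k))) := by
  have hc : ∀ (i : Fin 2) (k : Fin n), ![c, d] i ≠ y k := fun i k => by
    fin_cases i
    exacts [h.c_ne_y k.2, h.d_ne_y hcd hdy k.2]
  have hd : ∀ (i : Fin 2) (k : Fin n), ![c, d] i ≠ z k := fun i k => by
    fin_cases i
    exacts [h.symm.c_ne_y k.2, h.symm.d_ne_y hcd hdz k.2]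
  have hinj : Function.Injective ![c, d] := by
    intro i j e
    fin_cases i <;> fin_cases j
    exacts [rfl, absurd e hcd.ne, absurd e hcd.ne', rfl]
  refine hinj.sumElim (Function.Injective.sumElim ?_ ?_ ?_) ?_
  · exact fun i j e => Fin.ext (h.path_y.1 i i.2 j j.2 e)
  · exact fun i j e => Fin.ext (h.path_z.1 i i.2 j j.2 e)
  · exact fun i j => h.y_ne_z i.2 j.2
  · rintro i (j | j)
    exacts [hc i j, hd i j]

theorem not_F1 (h : Fork G n c y z) (hfree : ¬ HasInducedCopyG (F1G n) G)
    (hyz : ∀ k < n, ∀ l < n, ¬ G.Adj (y k) (z l)) (hcd : G.Adj c d)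
    (hdy : ∀ k < n, ¬ G.Adj d (y k)) (hdz : ∀ k < n, ¬ G.Adj d (z k)) : False := by
  refine hfree ⟨_, h.injective hcd hdy hdz, ?_⟩
  have hsymm : ∀ u v, G.Adj u v ↔ G.Adj v u := G.adj_comm
  rintro (i | i | i) (j | j | j)
  · fin_cases i <;> fin_cases j <;> simp [F1G, hcd, hcd.symm]
  · fin_cases i <;> simp [F1G, h.adj_y, hdy]
  · fin_cases i <;> simp [F1G, h.adj_z, hdz]
  · fin_cases j <;> simp [F1G, hsymm (y i), h.adj_y, hdy]
  · simp [F1G, h.path_y.2]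
    rintro h rfl
    omega
  · simp [F1G, hyz]
  · fin_cases j <;> simp [F1G, hsymm (z i), h.adj_z, hdz]
  · simp [F1G, hsymm (z i), hyz]
  · simp [F1G, h.path_z.2]
    rintro h rfl
    omega

theorem not_F2 (h : Fork G n c y z) (hfree : ¬ HasInducedCopyG (F2G n) G)
    (hyz : G.Adj (y 0) (z 0)) (hcd : G.Adj c d)
    (hdy : ∀ k < n, ¬ G.Adj d (y k)) (hdz : ∀ k < n, ¬ G.Adj d (z k)) : False := by
  refine hfree ⟨_, h.injective hcd hdy hdz, ?_⟩
  have hsymm : ∀ u v, G.Adj u v ↔ G.Adj v u := G.adj_comm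
  have hyz' : ∀ k < n, ∀ l < n, (G.Adj (y k) (z l) ↔ k = 0 ∧ l = 0) := fun k hk l hl =>
    ⟨h.cross k hk l hl, by rintro ⟨rfl, rfl⟩; exact hyz⟩
  rintro (i | i | i) (j | j | j)
  · fin_cases i <;> fin_cases j <;> simp [F2G, F1G, YZEdgeG, hcd, hcd.symm]
  · fin_cases i <;> simp [F2G, F1G, YZEdgeG, h.adj_y, hdy]
  · fin_cases i <;> simp [F2G, F1G, YZEdgeG, h.adj_z, hdz]
  · fin_cases j <;> simp [F2G, F1G, YZEdgeG, hsymm (y i), h.adj_y, hdy]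
  · simp [F2G, F1G, YZEdgeG, h.path_y.2]
    rintro h rfl
    omega
  · simp [F2G, F1G, YZEdgeG, hyz']
  · fin_cases j <;> simp [F2G, F1G, YZEdgeG, hsymm (z i), h.adj_z, hdz]
  · simp [F2G, F1G, YZEdgeG, hsymm (z i), hyz', and_comm]
  · simp [F2G, F1G, YZEdgeG, h.path_z.2]
    rintro h rfl
    omega

end Fork

/-- A vertex attached to two consecutive vertices of a long induced directed path can be inserted
between them. -/
theorem Fork.arcs {E : V → V → Prop} (hE : ∀ u v, E u v → ¬ E v u)
    (h : Fork (SimpleGraph.fromRel E) n c y z) (hD : CondD2 n E)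
    (hy : ∀ k, k + 1 < n → E (y (k + 1)) (y k)) (hz : ∀ k, k + 1 < n → E (z k) (z (k + 1)))
    (hyz : E (y 0) (z 0)) : E (y 0) c ∧ E c (z 0) := by
  have hn := h.two_le
  have hinj : Function.Injective (Sum.elim (fun _ : Unit => c)
      (Sum.elim (fun k : Fin n => y k) (fun k : Fin n => z k))) := by
    refine Function.Injective.sumElim (fun _ _ _ => rfl) (Function.Injective.sumElim ?_ ?_ ?_) ?_
    · exact fun i j e => Fin.ext (h.path_y.1 i i.2 j j.2 e)
    · exact fun i j e => Fin.ext (h.path_z.1 i i.2 j j.2 e)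
    · exact fun i j => h.y_ne_z i.2 j.2
    · rintro _ (j | j)
      exacts [h.c_ne_y j.2, h.symm.c_ne_y j.2]
  have hcc : ¬ E c c := fun h => hE _ _ h h
  have hEy : ∀ k < n, ∀ l < n, (E (y k) (y l) ↔ l + 1 = k) := fun k hk l hl => by
    constructor
    · intro e
      rcases (h.path_y.2 k hk l hl).1 ((adj_iff hE).2 (Or.inl e)) with rfl | h'
      · exact absurd e (hE _ _ (hy k hl))
      · exact h'
    · rintro rfl
      exact hy l hk
  have hEz : ∀ k < n, ∀ l < n, (E (z k) (z l) ↔ k + 1 = l) := fun k hk l hl => by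
    constructor
    · intro e
      rcases (h.path_z.2 k hk l hl).1 ((adj_iff hE).2 (Or.inl e)) with h' | rfl
      · exact h'
      · exact absurd e (hE _ _ (hz l hk))
    · rintro rfl
      exact hz k hl
  have hEyz : ∀ k < n, ∀ l < n, (E (y k) (z l) ↔ k = 0 ∧ l = 0) := fun k hk l hl =>
    ⟨fun e => h.cross k hk l hl ((adj_iff hE).2 (Or.inl e)), by rintro ⟨rfl, rfl⟩; exact hyz⟩
  have hEzy : ∀ k < n, ∀ l < n, ¬ E (z l) (y k) := fun k hk l hl e => by
    obtain ⟨rfl, rfl⟩ := h.cross k hk l hl ((adj_iff hE).2 (Or.inr e))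
    exact hE _ _ hyz e
  have hcy : ∀ k < n, (E c (y k) ↔ k = 0 ∧ E c (y 0)) := fun k hk =>
    ⟨fun e => by
      obtain rfl := (h.adj_y k hk).1 ((adj_iff hE).2 (Or.inl e))
      exact ⟨rfl, e⟩, by rintro ⟨rfl, e⟩; exact e⟩
  have hyc : ∀ k < n, (E (y k) c ↔ k = 0 ∧ E (y 0) c) := fun k hk =>
    ⟨fun e => by
      obtain rfl := (h.adj_y k hk).1 ((adj_iff hE).2 (Or.inr e))
      exact ⟨rfl, e⟩, by rintro ⟨rfl, e⟩; exact e⟩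
  have hcz : ∀ k < n, (E c (z k) ↔ k = 0 ∧ E c (z 0)) := fun k hk =>
    ⟨fun e => by
      obtain rfl := (h.adj_z k hk).1 ((adj_iff hE).2 (Or.inl e))
      exact ⟨rfl, e⟩, by rintro ⟨rfl, e⟩; exact e⟩
  have hzc : ∀ k < n, (E (z k) c ↔ k = 0 ∧ E (z 0) c) := fun k hk =>
    ⟨fun e => by
      obtain rfl := (h.adj_z k hk).1 ((adj_iff hE).2 (Or.inr e))
      exact ⟨rfl, e⟩, by rintro ⟨rfl, e⟩; exact e⟩
  rcases (adj_iff hE).1 ((h.adj_y 0 (by omega)).2 rfl) with e | e <;>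
    rcases (adj_iff hE).1 ((h.adj_z 0 (by omega)).2 rfl) with e' | e' <;>
    have e₁ := hE _ _ e <;> have e₂ := hE _ _ e'
  · refine absurd ⟨_, hinj, ?_⟩ hD.2.1
    rintro (_ | i | i) (_ | j | j) <;> simp [D2Rel, *]
  · refine absurd ⟨_, hinj, ?_⟩ hD.1
    rintro (_ | i | i) (_ | j | j) <;> simp [D1Rel, *]
  · exact ⟨e, e'⟩
  · refine absurd ⟨_, hinj, ?_⟩ hD.2.2
    rintro (_ | i | i) (_ | j | j) <;> simp [D3Rel, *]

end Configurations

/-! ### Vertices attached to an induced path -/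

/-- The vertex `x` lies off the path `p 0, …, p (m - 1)`, and its first and last neighbours on that
path are `p i` and `p j`. -/
structure Attached {V : Type} (G : SimpleGraph V) (p : ℕ → V) (m : ℕ) (x : V) (i j : ℕ) :
    Prop where
  ne : ∀ k < m, x ≠ p k
  le : i ≤ j
  lt : j < m
  adj_fst : G.Adj x (p i)
  adj_lst : G.Adj x (p j)
  bounds : ∀ k < m, G.Adj x (p k) → i ≤ k ∧ k ≤ j

section Attached

variable {V : Type} {G : SimpleGraph V} {p : ℕ → V} {m n : ℕ} {x x' d : V} {i j i' j' : ℕ}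

theorem exists_attached (hne : ∀ k < m, x ≠ p k) (hadj : ∃ k < m, G.Adj x (p k)) :
    ∃ i j, Attached G p m x i j := by
  classical
  obtain ⟨k₀, hk₀, hk₀'⟩ := hadj
  let S := (Finset.range m).filter fun k => G.Adj x (p k)
  have hS : ∀ k, k ∈ S ↔ k < m ∧ G.Adj x (p k) := by simp [S]
  have hne' : S.Nonempty := ⟨k₀, (hS k₀).2 ⟨hk₀, hk₀'⟩⟩
  have hmin := (hS _).1 (S.min'_mem hne')
  have hmax := (hS _).1 (S.max'_mem hne')
  exact ⟨S.min' hne', S.max' hne', hne, S.min'_le _ (S.max'_mem hne'), hmax.1, hmin.2, hmax.2,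
    fun k hk h => ⟨S.min'_le k ((hS k).2 ⟨hk, h⟩), S.le_max' k ((hS k).2 ⟨hk, h⟩)⟩⟩

theorem IndPath.reverse (hp : IndPath G p m) : IndPath G (fun k => p (m - 1 - k)) m := by
  rcases Nat.eq_zero_or_pos m with rfl | hm
  · exact ⟨by omega, by omega⟩
  · exact hp.backward (by omega) (by omega)

namespace Attached

theorem reverse (h : Attached G p m x i j) :
    Attached G (fun k => p (m - 1 - k)) m x (m - 1 - j) (m - 1 - i) := by
  obtain ⟨h1, h2, h3, h4, h5, h6⟩ := h
  refine ⟨fun k hk => h1 _ (by omega), by omega, by omega, ?_, ?_, fun k hk hadj => ?_⟩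
  · rwa [show m - 1 - (m - 1 - j) = j by omega]
  · rwa [show m - 1 - (m - 1 - i) = i by omega]
  · have := h6 _ (by omega) hadj
    omega

theorem adj_up (h : Attached G p m x i j) {k : ℕ} (hk : j + k < m) :
    G.Adj x (p (j + k)) ↔ k = 0 :=
  ⟨fun e => by have := h.bounds _ hk e; omega, by rintro rfl; exact h.adj_lst⟩

theorem adj_down (h : Attached G p m x i j) {k : ℕ} (hk : k ≤ i) :
    G.Adj x (p (i - k)) ↔ k = 0 :=
  ⟨fun e => by have := h.bounds _ (by have := h.le; have := h.lt; omega) e; omega,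
    by rintro rfl; exact h.adj_fst⟩

theorem not_adj (h : Attached G p m x i j) {k : ℕ} (hk : k < m) (hk' : k < i ∨ j < k) :
    ¬ G.Adj x (p k) := fun e => by
  have := h.bounds k hk e
  omega

theorem path_up (h : Attached G p m x i j) (hp : IndPath G p m) (hj : j + n ≤ m) :
    IndPath G (consSeq x fun k => p (j + k)) (n + 1) :=
  (hp.shift hj).cons (fun _ _ => h.ne _ (by omega)) fun _ _ => h.adj_up (by omega)

/-- A fork on `p i`, one of whose branches leaves the path `p` for `x`. -/
theorem fork_of_fst (h : Attached G p m x i j) (hp : IndPath G p m) (hn : 2 ≤ n) (hi : n ≤ i)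
    (hj : j + n < m) (hij : i + 2 ≤ j) :
    Fork G n (p i) (fun k => p (i - 1 - k)) (consSeq x fun k => p (j + k)) where
  two_le := hn
  path_y := hp.backward (by omega) (by omega)
  path_z := (h.path_up (n := n) hp (by omega)).mono (by omega)
  adj_y k hk := (hp.2 _ (by omega) _ (by omega)).trans (by omega)
  adj_z := by
    rintro (_ | k) hk
    · exact iff_of_true h.adj_fst.symm rfl
    · exact (hp.2 _ (by omega) _ (by omega)).trans (by omega)
  cross := by
    rintro k hk (_ | l) hl e
    · exact absurd e.symm (h.not_adj (by omega) (by omega))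
    · have := (hp.2 _ (by omega) _ (by omega)).1 e
      omega

theorem fork_self (h : Attached G p m x i j) (hp : IndPath G p m) (hn : 2 ≤ n) (hi : n ≤ i)
    (hj : j + n < m) (hij : i < j) : Fork G n x (fun k => p (i - k)) (fun k => p (j + k)) where
  two_le := hn
  path_y := hp.backward (by omega) (by omega)
  path_z := hp.shift (by omega)
  adj_y k hk := h.adj_down (by omega)
  adj_z k hk := h.adj_up (by omega)
  cross k hk l hl e := by
    have := (hp.2 _ (by omega) _ (by omega)).1 e
    omega

theorem fst_lt_lst (h : Attached G p m x i j) (hp : IndPath G p m) (hn : 2 ≤ n)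
    (hF1 : ¬ HasInducedCopyG (F1G n) G) (hi : n ≤ i) (hj : j + n < m) : i < j := by
  by_contra hij
  obtain rfl : i = j := by have := h.le; omega
  have hf : Fork G n (p i) (fun k => p (i - 1 - k)) (fun k => p (i + 1 + k)) :=
    { two_le := hn
      path_y := hp.backward (by omega) (by omega)
      path_z := hp.shift (by omega)
      adj_y := fun k hk => (hp.2 _ (by omega) _ (by omega)).trans (by omega)
      adj_z := fun k hk => (hp.2 _ (by omega) _ (by omega)).trans (by omega)
      cross := fun k hk l hl e => by
        have := (hp.2 _ (by omega) _ (by omega)).1 e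
        omega }
  refine hf.not_F1 (d := x) hF1 (fun k hk l hl e => ?_) h.adj_fst.symm
    (fun k hk => h.not_adj (by omega) (by omega)) (fun k hk => h.not_adj (by omega) (by omega))
  have := (hp.2 _ (by omega) _ (by omega)).1 e
  omega

theorem lst_le (h : Attached G p m x i j) (hp : IndPath G p m) (hn : 2 ≤ n)
    (hF1 : ¬ HasInducedCopyG (F1G n) G) (hF2 : ¬ HasInducedCopyG (F2G n) G)
    (hi : n ≤ i) (hj : j + n < m) : j ≤ i + 3 := by
  by_contra! hij
  by_cases h1 : G.Adj x (p (i + 1))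
  · by_cases h2 : G.Adj x (p (i + 2))
    · refine (h.fork_self hp hn hi hj (by omega)).not_F1 hF1 (fun k hk l hl e => ?_) h2
        (fun k hk e => ?_) (fun k hk e => ?_) <;>
      · have := (hp.2 _ (by omega) _ (by omega)).1 e
        omega
    · have hf : Fork G n (p (i + 1)) (fun k => p (i - k)) (consSeq x fun k => p (j + k)) :=
        { two_le := hn
          path_y := hp.backward (by omega) (by omega)
          path_z := (h.path_up (n := n) hp (by omega)).mono (by omega)
          adj_y := fun k hk => (hp.2 _ (by omega) _ (by omega)).trans (by omega)
          adj_z := by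
            rintro (_ | k) hk
            · exact iff_of_true h1.symm rfl
            · exact (hp.2 _ (by omega) _ (by omega)).trans (by omega)
          cross := by
            rintro k hk (_ | l) hl e
            · exact ⟨(h.adj_down (by omega)).1 e.symm, rfl⟩
            · have := (hp.2 _ (by omega) _ (by omega)).1 e
              omega }
      refine hf.not_F2 (d := p (i + 2)) hF2 h.adj_fst.symm
        ((hp.2 _ (by omega) _ (by omega)).2 (by omega)) (fun k hk e => ?_) ?_
      · have := (hp.2 _ (by omega) _ (by omega)).1 e
        omega
      · rintro (_ | k) hk e
        · exact h2 e.symm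
        · have := (hp.2 _ (by omega) _ (by omega)).1 e
          omega
  · refine (h.fork_of_fst hp hn hi hj (by omega)).not_F1 (d := p (i + 1)) hF1 ?_
      ((hp.2 _ (by omega) _ (by omega)).2 (by omega)) (fun k hk e => ?_) ?_
    · rintro k hk (_ | l) hl e
      · exact h.not_adj (by omega) (by omega) e.symm
      · have := (hp.2 _ (by omega) _ (by omega)).1 e
        omega
    · have := (hp.2 _ (by omega) _ (by omega)).1 e
      omega
    · rintro (_ | k) hk e
      · exact h1 e.symm
      · have := (hp.2 _ (by omega) _ (by omega)).1 e
        omega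

/-- A vertex attached to the middle of the path has no neighbour at distance two from the path. -/
theorem no_pendant (h : Attached G p m x i j) (hp : IndPath G p m) (hn : 2 ≤ n)
    (hF1 : ¬ HasInducedCopyG (F1G n) G) (hF2 : ¬ HasInducedCopyG (F2G n) G)
    (hi : n ≤ i) (hj : j + n < m) (hd : ∀ k < m, ¬ G.Adj d (p k)) : ¬ G.Adj x d := by
  intro hxd
  have hij := h.fst_lt_lst hp hn hF1 hi hj
  have hf := h.fork_self hp hn hi hj hij
  by_cases hij' : i + 1 = j
  · exact hf.not_F2 hF2 ((hp.2 _ (by omega) _ (by omega)).2 (by omega)) hxd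
      (fun k hk => hd _ (by omega)) (fun k hk => hd _ (by omega))
  · refine hf.not_F1 hF1 (fun k hk l hl e => ?_) hxd
      (fun k hk => hd _ (by omega)) (fun k hk => hd _ (by omega))
    have := (hp.2 _ (by omega) _ (by omega)).1 e
    omega

/-- A vertex having a neighbour at distance two from the path attaches to a short segment. -/
theorem lst_le_of_pendant (h : Attached G p m x i j) (hp : IndPath G p m) (hn : 2 ≤ n)
    (hstar : ¬ HasInducedCopyG (StarG n) G) (hF1 : ¬ HasInducedCopyG (F1G n) G)
    (hd : ∀ k < m, ¬ G.Adj d (p k)) (hxd : G.Adj x d) : j ≤ i + (n + 1) * (2 * n + 2) := by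
  classical
  by_contra! hij
  have hlt := h.lt
  have hwin : ∀ t ≤ n, t * (2 * n + 2) + (2 * n + 2) ≤ (n + 1) * (2 * n + 2) := fun t ht => by
    have := Nat.mul_le_mul_right (2 * n + 2) (Nat.succ_le_succ ht)
    rwa [Nat.succ_mul] at this
  have hnbr : ∀ t ≤ n, ∃ a, i + t * (2 * n + 2) ≤ a ∧ a ≤ i + t * (2 * n + 2) + 2 * n ∧
      G.Adj x (p a) := by
    intro t ht
    by_contra! hno
    have hw := hwin t ht
    obtain ⟨s, hs⟩ : ∃ s, s = i + t * (2 * n + 2) := ⟨_, rfl⟩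
    rw [← hs] at hno
    -- the neighbours of `x` around a long gap
    have hb : ∃ b, s ≤ b ∧ G.Adj x (p b) := ⟨j, by omega, h.adj_lst⟩
    obtain ⟨hsb, hxb⟩ := Nat.find_spec hb
    have hbj : Nat.find hb ≤ j := Nat.find_min' hb ⟨by omega, h.adj_lst⟩
    have hbmin : ∀ k, s ≤ k → k < Nat.find hb → ¬ G.Adj x (p k) := fun k hk hk' e =>
      Nat.find_min hb hk' ⟨hk, e⟩
    generalize Nat.find hb = b at hsb hxb hbj hbmin
    have hsb' : s + 2 * n < b := by
      by_contra! hle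
      exact hno b hsb hle hxb
    have hxa := Nat.findGreatest_spec (P := fun k => G.Adj x (p k)) (m := i) (n := s)
      (by omega) h.adj_fst
    have hamax := fun k => Nat.findGreatest_is_greatest (P := fun k => G.Adj x (p k))
      (n := s) (k := k)
    have has := Nat.findGreatest_le (P := fun k => G.Adj x (p k)) s
    generalize Nat.findGreatest (fun k => G.Adj x (p k)) s = a at hxa hamax has
    have hgap : ∀ k, a < k → k < b → ¬ G.Adj x (p k) := fun k hk hk' => by
      rcases Nat.le_total k s with hks | hks
      · exact hamax k hk hks
      · exact hbmin k hks hk'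
    have hf : Fork G n x (fun k => p (a + k)) (fun k => p (b - k)) :=
      { two_le := hn
        path_y := hp.shift (by omega)
        path_z := hp.backward (by omega) (by omega)
        adj_y := fun k hk => ⟨fun e => by
          by_contra hk0
          exact hgap (a + k) (by omega) (by omega) e, by rintro rfl; exact hxa⟩
        adj_z := fun k hk => ⟨fun e => by
          by_contra hk0
          exact hgap (b - k) (by omega) (by omega) e, by rintro rfl; exact hxb⟩
        cross := fun k hk l hl e => by
          have := (hp.2 _ (by omega) _ (by omega)).1 e
          omega }
    refine hf.not_F1 hF1 (fun k hk l hl e => ?_) hxd (fun k hk => hd _ (by omega))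
      (fun k hk => hd _ (by omega))
    have := (hp.2 _ (by omega) _ (by omega)).1 e
    omega
  choose! f hf₁ hf₂ hf₃ using hnbr
  have hfm : ∀ t ≤ n, f t < m := fun t ht => by
    have := hwin t ht
    have := hf₂ t ht
    omega
  have hsep : ∀ s ≤ n, ∀ t ≤ n, s < t → f s + 2 ≤ f t := fun s hs t ht hst => by
    have h1 := hf₂ s hs
    have h2 := hf₁ t ht
    have h3 := Nat.mul_le_mul_right (2 * n + 2) (Nat.succ_le_of_lt hst)
    rw [Nat.succ_mul] at h3
    omega
  have hcard := indepBound_neighbors hstar x {v | G.Adj x v} (fun _ h => h)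
    ((Finset.range (n + 1)).image fun t => p (f t)) (by
      intro v hv
      obtain ⟨t, ht, rfl⟩ := Finset.mem_image.mp hv
      exact hf₃ t (Nat.lt_succ_iff.mp (Finset.mem_range.mp ht))) (by
      intro u hu v hv e
      obtain ⟨s, hs, rfl⟩ := Finset.mem_image.mp hu
      obtain ⟨t, ht, rfl⟩ := Finset.mem_image.mp hv
      have hs := Nat.lt_succ_iff.mp (Finset.mem_range.mp hs)
      have ht := Nat.lt_succ_iff.mp (Finset.mem_range.mp ht)
      have := (hp.2 _ (hfm s hs) _ (hfm t ht)).1 e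
      rcases lt_trichotomy s t with hst | rfl | hst
      · have := hsep s hs t ht hst
        omega
      · omega
      · have := hsep t ht s hs hst
        omega)
  rw [Finset.card_image_of_injOn, Finset.card_range] at hcard
  · omega
  · intro s hs t ht e
    have hs := Nat.lt_succ_iff.mp (Finset.mem_range.mp hs)
    have ht := Nat.lt_succ_iff.mp (Finset.mem_range.mp ht)
    have e' := hp.1 _ (hfm s hs) _ (hfm t ht) e
    rcases lt_trichotomy s t with hst | hst | hst
    · have := hsep s hs t ht hst
      omega
    · exact hst
    · have := hsep t ht s hs hst
      omega

theorem not_adj_attached (h : Attached G p m x i j) (h' : Attached G p m x' i' j')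
    (hp : IndPath G p m) (hn : 2 ≤ n) (hF1 : ¬ HasInducedCopyG (F1G n) G) (hi : n ≤ i)
    (hij : i + 2 ≤ j) (hji : j + 1 < i') (hj : j' + n < m) : ¬ G.Adj x x' := by
  intro e
  have hle := h'.le
  have hf : Fork G n x (fun k => p (i - k)) (consSeq x' fun k => p (j' + k)) :=
    { two_le := hn
      path_y := hp.backward (by omega) (by omega)
      path_z := (h'.path_up (n := n) hp (by omega)).mono (by omega)
      adj_y := fun k hk => h.adj_down (by omega)
      adj_z := by
        rintro (_ | k) hk
        · exact iff_of_true e rfl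
        · exact iff_of_false (h.not_adj (by omega) (by omega)) (by omega)
      cross := by
        rintro k hk (_ | l) hl e
        · exact absurd e.symm (h'.not_adj (by omega) (by omega))
        · have := (hp.2 _ (by omega) _ (by omega)).1 e
          omega }
  refine hf.not_F1 hF1 ?_ h.adj_lst (fun k hk e => ?_) ?_
  · rintro k hk (_ | l) hl e
    · exact absurd e.symm (h'.not_adj (by omega) (by omega))
    · have := (hp.2 _ (by omega) _ (by omega)).1 e
      omega
  · have := (hp.2 _ (by omega) _ (by omega)).1 e
    omega
  · rintro (_ | k) hk e
    · exact h'.not_adj (by omega) (by omega) e.symm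
    · have := (hp.2 _ (by omega) _ (by omega)).1 e
      omega

end Attached

end Attached

/-! ### Vertices far from a longest induced path -/

section Distance

variable {V : Type} {G : SimpleGraph V} {p : ℕ → V} {m n : ℕ}

theorem exists_adj_dist (hG : G.Connected) {u v : V} {d : ℕ} (h : G.dist u v = d + 1) :
    ∃ w, G.Adj u w ∧ G.dist w v ≤ d := by
  obtain ⟨w, hw⟩ := hG.exists_walk_length_eq_dist u v
  cases w with
  | nil => simp at h
  | cons hadj w' =>
    refine ⟨_, hadj, (SimpleGraph.dist_le w').trans ?_⟩
    rw [h, SimpleGraph.Walk.length_cons] at hw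
    omega

theorem dist_le_succ_of_adj (hG : G.Connected) {u w : V} (v : V) (h : G.Adj u w) :
    G.dist u v ≤ G.dist w v + 1 := by
  have := hG.dist_triangle (u := u) (v := w) (w := v)
  rw [SimpleGraph.dist_eq_one_iff_adj.2 h] at this
  omega

theorem IndPath.dist_le (hG : G.Connected) (hp : IndPath G p m) {a b : ℕ} (hab : a + b < m) :
    G.dist (p (a + b)) (p a) ≤ b := by
  induction b with
  | zero => simp
  | succ b ih =>
    have := ih (by omega)
    have := dist_le_succ_of_adj hG (p a) ((hp.2 (a + (b + 1)) hab (a + b) (by omega)).2 (by omega))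
    omega

/-- Descending from `v` towards the path `p` one meets a vertex `x` attached to `p`, and every
induced path that starts in `x` and continues inside `p` extends to one that starts in `v`. -/
theorem exists_tail (hG : G.Connected) (d : ℕ) : ∀ v : V, (∀ k < m, d + 1 ≤ G.dist v (p k)) →
    (∃ k < m, G.dist v (p k) = d + 1) → ∃ x, (∀ k < m, x ≠ p k) ∧ (∃ k < m, G.Adj x (p k)) ∧
      G.dist v x ≤ d ∧ (1 ≤ d → ∃ u, G.Adj x u ∧ ∀ k < m, ¬ G.Adj u (p k)) ∧
      ∀ q r, IndPath G q (r + 1) → q 0 = x → (∀ t, 1 ≤ t → t ≤ r → ∃ k < m, q t = p k) →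
        ∃ q', IndPath G q' (r + 1 + d) ∧ q' 0 = v ∧
          ∀ t, 1 ≤ t → t < r + 1 + d → ∃ k < m, G.dist (q' t) (p k) ≤ d := by
  induction d with
  | zero =>
    intro v hv ⟨k, hk, hk'⟩
    refine ⟨v, fun k hk e => ?_, ⟨k, hk, SimpleGraph.dist_eq_one_iff_adj.1 hk'⟩, by simp, by omega,
      fun q r hq hq0 ht => ⟨q, hq, hq0, fun t h1 h2 => ?_⟩⟩
    · have := hv k hk
      simp [e] at this
    · obtain ⟨k, hk, hk'⟩ := ht t h1 (by omega)
      exact ⟨k, hk, by simp [hk']⟩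
  | succ d ih =>
    intro v hv ⟨k, hk, hk'⟩
    obtain ⟨w, hvw, hw⟩ := exists_adj_dist hG hk'
    have hlow : ∀ k < m, d + 1 ≤ G.dist w (p k) := fun k hk => by
      have := hv k hk
      have := dist_le_succ_of_adj hG (p k) hvw
      omega
    obtain ⟨x, hne, hadj, hdist, hpend, hext⟩ := ih w hlow ⟨k, hk, le_antisymm hw (hlow k hk)⟩
    refine ⟨x, hne, hadj, ?_, fun _ => ?_, fun q r hq hq0 ht => ?_⟩
    · have := dist_le_succ_of_adj hG x hvw
      omega
    · rcases Nat.eq_zero_or_pos d with rfl | hd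
      · obtain rfl : w = x := (hG.dist_eq_zero_iff).1 (by omega)
        refine ⟨v, hvw.symm, fun k hk e => ?_⟩
        have := hv k hk
        rw [SimpleGraph.dist_eq_one_iff_adj.2 e] at this
        omega
      · exact hpend hd
    · obtain ⟨q', hq', hq'0, ht'⟩ := hext q r hq hq0 ht
      have hfar : ∀ t, 1 ≤ t → t < r + 1 + d → v ≠ q' t ∧ ¬ G.Adj v (q' t) := fun t h1 h2 => by
        obtain ⟨k, hk, hk'⟩ := ht' t h1 h2
        have := hv k hk
        refine ⟨by rintro rfl; omega, fun e => ?_⟩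
        have := dist_le_succ_of_adj hG (p k) e
        omega
      refine ⟨consSeq v q', hq'.cons (fun t ht => ?_) (fun t ht => ?_), rfl, ?_⟩
      · rcases Nat.eq_zero_or_pos t with rfl | h0
        · exact hq'0 ▸ hvw.ne
        · exact (hfar t h0 ht).1
      · rcases Nat.eq_zero_or_pos t with rfl | h0
        · simpa [hq'0] using hvw
        · exact iff_of_false (hfar t h0 ht).2 (by omega)
      · rintro (_ | _ | t) h1 h2
        · omega
        · exact ⟨k, hk, by simpa [consSeq, hq'0] using hw.trans (by omega)⟩
        · obtain ⟨k, hk, hk'⟩ := ht' (t + 1) (by omega) (by omega)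
          exact ⟨k, hk, hk'.trans (by omega)⟩

/-- Every vertex that is not on a longest induced path and has no neighbour on it is close to
one of its ends. -/
theorem dist_end_le (hG : G.Connected) (hp : IndPath G p m) (hn : 2 ≤ n)
    (hmax : ∀ q r, IndPath G q r → r ≤ m) (hstar : ¬ HasInducedCopyG (StarG n) G)
    (hF1 : ¬ HasInducedCopyG (F1G n) G) (hF2 : ¬ HasInducedCopyG (F2G n) G) {v : V}
    (hm : 0 < m) (hne : ∀ k < m, v ≠ p k) (hadj : ∀ k < m, ¬ G.Adj v (p k)) :
    G.dist v (p 0) ≤ 2 * n + (n + 1) * (2 * n + 2) ∨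
      G.dist v (p (m - 1)) ≤ 2 * n + (n + 1) * (2 * n + 2) := by
  classical
  obtain ⟨k, hk, hmin⟩ := (Finset.range m).exists_min_image (fun k => G.dist v (p k))
    ⟨0, by simpa using hm⟩
  have htwo : 2 ≤ G.dist v (p k) := by
    rw [Finset.mem_range] at hk
    by_contra! h
    rcases (by omega : G.dist v (p k) = 0 ∨ G.dist v (p k) = 1) with h | h
    · exact hne k hk (hG.dist_eq_zero_iff.1 h)
    · exact hadj k hk (SimpleGraph.dist_eq_one_iff_adj.1 h)
  obtain ⟨d, hd⟩ : ∃ d, G.dist v (p k) = d + 1 := ⟨_, (Nat.succ_pred_eq_of_pos (by omega)).symm⟩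
  obtain ⟨x, hxne, hxadj, hdist, hpend, hext⟩ := exists_tail (p := p) (m := m) hG d v
    (fun l hl => hd ▸ hmin l (by simpa using hl)) ⟨k, by simpa using hk, hd⟩
  obtain ⟨u, hxu, hu⟩ := hpend (by omega)
  obtain ⟨i, j, h⟩ := exists_attached hxne hxadj
  have hij := h.lst_le_of_pendant hp hn hstar hF1 hu hxu
  have hlt := h.lt
  have hle := h.le
  have htri := fun w => hG.dist_triangle (u := v) (v := x) (w := w)
  by_cases hi : i < n
  · left
    obtain ⟨q, hq, -⟩ := hext _ (m - j) (h.path_up (n := m - j) hp (by omega)) rfl (by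
      rintro (_ | t) h1 h2
      · omega
      · exact ⟨j + t, by omega, rfl⟩)
    have h1 := hmax _ _ hq
    have h2 := dist_le_succ_of_adj hG (p 0) h.adj_fst
    have h3 := hp.dist_le hG (a := 0) (b := i) (by omega)
    rw [zero_add] at h3
    have := htri (p 0)
    omega
  · right
    have hj : m ≤ j + n := by
      by_contra! hj
      exact h.no_pendant hp hn hF1 hF2 (by omega) hj hu hxu
    obtain ⟨q, hq, -⟩ := hext _ (i + 1) (h.reverse.path_up (n := i + 1) hp.reverse (by omega)) rfl
      (by
        rintro (_ | t) h1 h2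
        · omega
        · exact ⟨m - 1 - (m - 1 - i + t), by omega, rfl⟩)
    have h1 := hmax _ _ hq
    have h2 := dist_le_succ_of_adj hG (p (m - 1)) h.adj_lst
    have h3 := hp.dist_le hG (a := j) (b := m - 1 - j) (by omega)
    rw [show j + (m - 1 - j) = m - 1 by omega, SimpleGraph.dist_comm] at h3
    have := htri (p (m - 1))
    omega

end Distance

/-! ### Counting turns -/

section Turns

variable {V : Type} {E : V → V → Prop} {n : ℕ}

theorem card_turns_le (hE : ∀ u v, E u v → ¬ E v u) (hD : CondD3 n E) {f : ℕ → V} {A S : Finset ℕ}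
    (hinj : ∀ a ∈ A, ∀ b ∈ A, f a = f b → a = b)
    (hadj : ∀ a ∈ A, ∀ b ∈ A, a < b →
      ((SimpleGraph.fromRel E).Adj (f a) (f b) ↔ ∀ c ∈ A, a < c → b ≤ c))
    (hS : ∀ a ∈ S, a ∈ A ∧ ∃ b ∈ A, ∃ c ∈ A, b < a ∧ a < c ∧
      ((E (f a) (f b) ∧ E (f a) (f c)) ∨ (E (f b) (f a) ∧ E (f c) (f a)))) : S.card ≤ n := by
  classical
  set e := A.orderEmbOfFin rfl with he
  have hmem : ∀ i, e i ∈ A := A.orderEmbOfFin_mem rfl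
  have hsurj : ∀ a ∈ A, ∃ i, e i = a := fun a ha => by
    have : a ∈ Set.range e := by rw [he, A.range_orderEmbOfFin rfl]; exact ha
    exact this
  have hlt : ∀ i j : Fin A.card, i < j →
      ((E (f (e i)) (f (e j)) ∨ E (f (e j)) (f (e i))) ↔ i.val + 1 = j.val) := by
    intro i j hij
    rw [← adj_iff hE, hadj _ (hmem i) _ (hmem j) (e.lt_iff_lt.2 hij)]
    constructor
    · intro h
      have h1 : i.val + 1 < A.card := by have := j.2; have : i.val < j.val := hij; omega
      have h2 := h (e ⟨i + 1, h1⟩) (hmem _) (e.lt_iff_lt.2 (by simp [Fin.lt_def]))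
      rw [e.le_iff_le, Fin.le_def] at h2
      have : i.val < j.val := hij
      simp only at h2
      omega
    · intro h c hc hic
      obtain ⟨k, rfl⟩ := hsurj c hc
      rw [e.lt_iff_lt, Fin.lt_def] at hic
      rw [e.le_iff_le, Fin.le_def]
      omega
  have hw : IsInducedPsPath E fun i => f (e i) := by
    refine ⟨fun i j h => e.injective (hinj _ (hmem i) _ (hmem j) h), fun i j => ?_⟩
    rcases lt_trichotomy i j with h | rfl | h
    · rw [hlt i j h]
      have : i.val < j.val := h
      omega
    · simpa using fun h => hE _ _ h h
    · rw [or_comm, hlt j i h]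
      have : j.val < i.val := h
      omega
  refine le_trans ?_ (hD _ _ hw)
  rw [turnCount, ← Set.ncard_image_of_injective _ e.injective, ← Set.ncard_coe_finset]
  refine Set.ncard_le_ncard (fun a ha => ?_) (Set.toFinite _)
  obtain ⟨haA, b, hb, c, hc, hba, hac, hturn⟩ := hS a ha
  obtain ⟨i, rfl⟩ := hsurj a haA
  obtain ⟨j, rfl⟩ := hsurj b hb
  obtain ⟨k, rfl⟩ := hsurj c hc
  exact ⟨i, ⟨j, k, (hlt j i (e.lt_iff_lt.1 hba)).1 (by tauto), (hlt i k (e.lt_iff_lt.1 hac)).1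
    (by tauto), hturn⟩, rfl⟩

/-- The position `k` is a turn of the path `p 0, …, p (m - 1)`. -/
def IsTurn (E : V → V → Prop) (p : ℕ → V) (m k : ℕ) : Prop :=
  1 ≤ k ∧ k + 1 < m ∧ ((E (p k) (p (k - 1)) ∧ E (p k) (p (k + 1))) ∨
    (E (p (k - 1)) (p k) ∧ E (p (k + 1)) (p k)))

theorem card_isTurn_le (hE : ∀ u v, E u v → ¬ E v u) (hD : CondD3 n E) {p : ℕ → V} {m : ℕ}
    (hp : IndPath (SimpleGraph.fromRel E) p m) {T : Finset ℕ} (hT : ∀ k ∈ T, IsTurn E p m k) :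
    T.card ≤ n := by
  refine card_turns_le hE hD (f := p) (A := Finset.range m) ?_ ?_ fun k hk => ?_
  · simpa using hp.1
  · intro a ha b hb hab
    rw [Finset.mem_range] at ha hb
    rw [hp.2 a ha b hb]
    refine ⟨fun h c _ hc => by omega, fun h => ?_⟩
    have := h (a + 1) (by simp; omega) (by omega)
    omega
  · obtain ⟨h1, h2, h3⟩ := hT k hk
    exact ⟨by simp; omega, k - 1, by simp; omega, k + 1, by simp; omega, by omega, by omega, h3⟩

end Turns

/-! ### Rerouting an induced path through attached vertices -/

section Reroute

variable {V : Type} {E : V → V → Prop} {p : ℕ → V} {m n : ℕ}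

/-- The vertex `x`, with first and last neighbours `p i` and `p j` on the path, can replace the
inner vertices of the segment from `p i` to `p j` without turning at `p i` or `x`. -/
def Threads (E : V → V → Prop) (p : ℕ → V) (x : V) (i j : ℕ) : Prop :=
  (E (p (i - 1)) (p i) ∧ E (p i) x ∧ E x (p j)) ∨ (E (p i) (p (i - 1)) ∧ E x (p i) ∧ E (p j) x)

/-- The vertex `x` bypasses a segment in the middle of the path, but creates a turn. -/
structure BadBypass (E : V → V → Prop) (p : ℕ → V) (m n : ℕ) (x : V) (i j : ℕ) : Prop where
  attached : Attached (SimpleGraph.fromRel E) p m x i j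
  le_fst : n ≤ i
  lst_lt : j + n < m
  add_two_le : i + 2 ≤ j
  le_add_three : j ≤ i + 3
  not_threads : ¬ Threads E p x i j

theorem card_badBypass_le (hE : ∀ u v, E u v → ¬ E v u)
    (hp : IndPath (SimpleGraph.fromRel E) p m) (hn : 2 ≤ n)
    (hF1 : ¬ HasInducedCopyG (F1G n) (SimpleGraph.fromRel E)) (hD : CondD3 n E) {J : Finset ℕ}
    {ξ : ℕ → V} {ρ : ℕ → ℕ} (hJ : ∀ i ∈ J, BadBypass E p m n (ξ i) i (ρ i))
    (hsep : ∀ i ∈ J, ∀ i' ∈ J, i < i' → i + 10 ≤ i') : J.card ≤ n := by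
  classical
  set G := SimpleGraph.fromRel E with hG
  let f : ℕ → V := fun k => if k - 1 ∈ J then ξ (k - 1) else p k
  let A : Finset ℕ := (Finset.range m).filter fun k => ¬ (k - 2 ∈ J ∧ ρ (k - 2) = k + 1)
  have hf_on : ∀ i ∈ J, f (i + 1) = ξ i := fun i hi => by simp [f, hi]
  have hf_off : ∀ k, k - 1 ∉ J → f k = p k := fun k hk => by simp [f, hk]
  have hA : ∀ k, k ∈ A ↔ k < m ∧ ¬ (k - 2 ∈ J ∧ ρ (k - 2) = k + 1) := by simp [A]
  have hfar : ∀ i ∈ J, ∀ k, i < k + 10 → k < i + 10 → k ∈ J → k = i := fun i hi k h1 h2 hk => by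
    rcases lt_trichotomy i k with h | h | h
    · have := hsep i hi k hk h
      omega
    · omega
    · have := hsep k hk i hi h
      omega
  have hfar' : ∀ i ∈ J, ∀ k, i < k + 10 → k < i + 10 → k ≠ i → k ∉ J := fun i hi k h1 h2 h3 hk =>
    h3 (hfar i hi k h1 h2 hk)
  have hnums : ∀ i ∈ J, 2 ≤ i ∧ i + 2 ≤ ρ i ∧ ρ i ≤ i + 3 ∧ ρ i + 2 < m := fun i hi => by
    have := (hJ i hi).le_fst
    have := (hJ i hi).lst_lt
    exact ⟨by omega, (hJ i hi).add_two_le, (hJ i hi).le_add_three, by omega⟩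
  have hA_prev : ∀ i ∈ J, i - 1 ∈ A ∧ f (i - 1) = p (i - 1) := fun i hi => by
    have := hnums i hi
    exact ⟨(hA _).2 ⟨by omega, fun h => hfar' i hi _ (by omega) (by omega) (by omega) h.1⟩,
      hf_off _ (hfar' i hi _ (by omega) (by omega) (by omega))⟩
  have hA_fst : ∀ i ∈ J, i ∈ A ∧ f i = p i := fun i hi => by
    have := hnums i hi
    exact ⟨(hA _).2 ⟨by omega, fun h => hfar' i hi _ (by omega) (by omega) (by omega) h.1⟩,
      hf_off _ (hfar' i hi _ (by omega) (by omega) (by omega))⟩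
  have hA_mid : ∀ i ∈ J, i + 1 ∈ A := fun i hi => by
    have := hnums i hi
    exact (hA _).2 ⟨by omega, fun h => hfar' i hi _ (by omega) (by omega) (by omega) h.1⟩
  have hA_lst : ∀ i ∈ J, ρ i ∈ A ∧ f (ρ i) = p (ρ i) := fun i hi => by
    have := hnums i hi
    refine ⟨(hA _).2 ⟨by omega, fun h => ?_⟩,
      hf_off _ (hfar' i hi _ (by omega) (by omega) (by omega))⟩
    have h1 := hfar i hi _ (by omega) (by omega) h.1
    rw [h1] at h
    omega
  have hA_next : ∀ i ∈ J, ∀ c ∈ A, i + 1 < c → ρ i ≤ c := fun i hi c hc hic => by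
    have := hnums i hi
    by_contra! hlt
    obtain rfl : c = i + 2 := by omega
    exact ((hA _).1 hc).2 ⟨hi, by simp only [Nat.add_sub_cancel]; omega⟩
  have hsplit : ∀ a, (∃ i ∈ J, a = i + 1) ∨ a - 1 ∉ J := fun a => by
    by_cases h : a - 1 ∈ J
    · have := hnums _ h
      exact Or.inl ⟨a - 1, h, by omega⟩
    · exact Or.inr h
  have hξp : ∀ i ∈ J, ∀ b < m, ξ i ≠ p b := fun i hi b hb => (hJ i hi).attached.ne b hb
  have hinj : ∀ a ∈ A, ∀ b ∈ A, f a = f b → a = b := by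
    intro a ha b hb
    have ham := ((hA a).1 ha).1
    have hbm := ((hA b).1 hb).1
    rcases hsplit a with ⟨i, hi, rfl⟩ | ha' <;> rcases hsplit b with ⟨j, hj, rfl⟩ | hb'
    · rw [hf_on i hi, hf_on j hj]
      intro e
      have hi' := (hJ i hi).attached
      have hj' := (hJ j hj).attached
      rw [e] at hi'
      have h1 := (hi'.bounds _ (hj'.le.trans_lt hj'.lt) hj'.adj_fst).1
      have h2 := (hj'.bounds _ (hi'.le.trans_lt hi'.lt) hi'.adj_fst).1
      omega
    · rw [hf_on i hi, hf_off b hb']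
      exact fun e => absurd e (hξp i hi b hbm)
    · rw [hf_on j hj, hf_off a ha']
      exact fun e => absurd e.symm (hξp j hj a ham)
    · rw [hf_off a ha', hf_off b hb']
      exact hp.1 a ham b hbm
  have hadj : ∀ a ∈ A, ∀ b ∈ A, a < b → (G.Adj (f a) (f b) ↔ ∀ c ∈ A, a < c → b ≤ c) := by
    intro a ha b hb hab
    have ham := ((hA a).1 ha).1
    have hbm := ((hA b).1 hb).1
    rcases hsplit a with ⟨i, hi, rfl⟩ | ha' <;> rcases hsplit b with ⟨j, hj, rfl⟩ | hb'
    · rw [hf_on i hi, hf_on j hj]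
      have h1 := hnums i hi
      have h2 := hsep i hi j hj (by omega)
      refine iff_of_false ((hJ i hi).attached.not_adj_attached (hJ j hj).attached hp hn hF1
        (hJ i hi).le_fst h1.2.1 (by omega) (hJ j hj).lst_lt) fun h => ?_
      have := h _ (hA_lst i hi).1 (by omega)
      omega
    · rw [hf_on i hi, hf_off b hb']
      have h1 := hnums i hi
      have h2 := hA_next i hi b hb hab
      constructor
      · intro e c hc hic
        exact ((hJ i hi).attached.bounds b hbm e).2.trans (hA_next i hi c hc hic)
      · intro h
        have := h _ (hA_lst i hi).1 (by omega)
        obtain rfl : b = ρ i := by omega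
        exact (hJ i hi).attached.adj_lst
    · rw [hf_on j hj, hf_off a ha']
      constructor
      · intro e c hc hac
        have := ((hJ j hj).attached.bounds a ham e.symm).1
        omega
      · intro h
        have := h _ (hA_fst j hj).1
        obtain rfl : a = j := by omega
        exact (hJ a hj).attached.adj_fst.symm
    · rw [hf_off a ha', hf_off b hb', hp.2 a ham b hbm]
      refine ⟨fun h c _ hc => by omega, fun h => ?_⟩
      have := h (a + 1) ((hA _).2 ⟨by omega, fun h => ha' h.1⟩) (by omega)
      omega
  let IsT : ℕ → Prop := fun a => a ∈ A ∧ ∃ b ∈ A, ∃ c ∈ A, b < a ∧ a < c ∧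
      ((E (f a) (f b) ∧ E (f a) (f c)) ∨ (E (f b) (f a) ∧ E (f c) (f a)))
  have hturn : ∀ i ∈ J, IsT i ∨ IsT (i + 1) := by
    intro i hi
    have h1 := hnums i hi
    have h2 := hA_prev i hi
    have h3 := hA_fst i hi
    have h4 := hA_lst i hi
    have h5 := hA_mid i hi
    have hat := (hJ i hi).attached
    have e1 : G.Adj (p (i - 1)) (p i) := (hp.2 _ (by omega) _ (by omega)).2 (by omega)
    have e2 := hat.adj_fst
    have e3 := hat.adj_lst
    rw [hG] at e1
    rw [adj_iff hE] at e1 e2 e3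
    have hbad := (hJ i hi).not_threads
    by_contra! hno
    have n1 := fun h => hno.1 ⟨h3.1, i - 1, h2.1, i + 1, h5, by omega, by omega, h⟩
    have n2 := fun h => hno.2 ⟨h5, i, h3.1, ρ i, h4.1, by omega, by omega, h⟩
    rw [h2.2, h3.2, hf_on i hi] at n1
    rw [h3.2, h4.2, hf_on i hi] at n2
    rcases e1 with e1 | e1 <;> rcases e2 with e2 | e2
    · exact n1 (Or.inr ⟨e1, e2⟩)
    · exact e3.elim (fun e3 => hbad (Or.inl ⟨e1, e2, e3⟩)) fun e3 => n2 (Or.inr ⟨e2, e3⟩)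
    · exact e3.elim (fun e3 => n2 (Or.inl ⟨e2, e3⟩)) fun e3 => hbad (Or.inr ⟨e1, e2, e3⟩)
    · exact n1 (Or.inl ⟨e1, e2⟩)
  let τ : ℕ → ℕ := fun i => if IsT i then i else i + 1
  have hτ : ∀ i ∈ J, IsT (τ i) := fun i hi => by
    by_cases h : IsT i
    · simp [τ, h]
    · simpa [τ, h] using (hturn i hi).resolve_left h
  have hτ' : ∀ i, τ i = i ∨ τ i = i + 1 := fun i => by
    by_cases h : IsT i <;> simp [τ, h]
  have hcard : (J.image τ).card = J.card := Finset.card_image_of_injOn fun i hi j hj e => by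
    have := hτ' i
    have := hτ' j
    have : τ i = τ j := e
    exact (hfar i hi j (by omega) (by omega) hj).symm
  rw [← hcard]
  refine card_turns_le hE hD hinj hadj fun a ha => ?_
  obtain ⟨i, hi, rfl⟩ := Finset.mem_image.1 ha
  exact hτ i hi

/-- The bad bypasses start near a bounded number of vertices of the path. -/
theorem exists_badBypass_centers (hE : ∀ u v, E u v → ¬ E v u)
    (hp : IndPath (SimpleGraph.fromRel E) p m) (hn : 2 ≤ n)
    (hF1 : ¬ HasInducedCopyG (F1G n) (SimpleGraph.fromRel E)) (hD : CondD3 n E) :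
    ∃ J : Finset ℕ, J.card ≤ n ∧ (∀ k ∈ J, k < m) ∧
      ∀ x i j, BadBypass E p m n x i j → ∃ k ∈ J, i < k + 10 ∧ k < i + 10 := by
  classical
  let B : Finset ℕ := (Finset.range m).filter fun i => ∃ x j, BadBypass E p m n x i j
  have hB : ∀ x i j, BadBypass E p m n x i j → i ∈ B := fun x i j h =>
    Finset.mem_filter.2 ⟨Finset.mem_range.2 (h.attached.le.trans_lt h.attached.lt), x, j, h⟩
  let C := B.powerset.filter fun J => ∀ i ∈ J, ∀ i' ∈ J, i < i' → i + 10 ≤ i'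
  have hC : ∀ J, J ∈ C ↔ J ⊆ B ∧ ∀ i ∈ J, ∀ i' ∈ J, i < i' → i + 10 ≤ i' := by simp [C]
  obtain ⟨J, hJ, hmax⟩ := C.exists_max_image Finset.card ⟨∅, (hC _).2 (by simp)⟩
  obtain ⟨hJB, hsep⟩ := (hC J).1 hJ
  have hbad : ∀ i : J, ∃ x j, BadBypass E p m n x i j := fun i => (Finset.mem_filter.1 (hJB i.2)).2
  refine ⟨J, ?_, fun k hk => Finset.mem_range.1 (Finset.mem_filter.1 (hJB hk)).1,
    fun x i j h => ?_⟩
  · have hbad' : ∀ i, ∃ x j, i ∈ J → BadBypass E p m n x i j := fun i => by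
      by_cases hi : i ∈ J
      · obtain ⟨x, j, h⟩ := hbad ⟨i, hi⟩
        exact ⟨x, j, fun _ => h⟩
      · exact ⟨p 0, 0, fun h => absurd h hi⟩
    choose ξ ρ hξ using hbad'
    exact card_badBypass_le hE hp hn hF1 hD hξ hsep
  · by_contra! hno
    have hi : i ∉ J := fun hi => by
      have := hno i hi
      omega
    have hins := hmax (insert i J) ((hC _).2 ⟨Finset.insert_subset (hB x i j h) hJB, ?_⟩)
    · rw [Finset.card_insert_of_notMem hi] at hins
      omega
    · intro a ha b hb hab
      rcases Finset.mem_insert.1 ha with rfl | ha' <;> rcases Finset.mem_insert.1 hb with rfl | hb'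
      · omega
      · have := hno b hb'
        omega
      · have := hno a ha'
        omega
      · exact hsep a ha' b hb' hab

end Reroute

/-! ### Covering the segments between turns -/

section Segments

variable {V : Type} {E : V → V → Prop} {p : ℕ → V} {m n : ℕ}

theorem IndPath.direction (hE : ∀ u v, E u v → ¬ E v u)
    (hp : IndPath (SimpleGraph.fromRel E) p m) {a b : ℕ} (hab : a ≤ b) (hb : b < m)
    (hturn : ∀ k, a < k → k < b → ¬ IsTurn E p m k) :
    (∀ k, a ≤ k → k < b → E (p k) (p (k + 1))) ∨ ∀ k, a ≤ k → k < b → E (p (k + 1)) (p k) := by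
  induction b, hab using Nat.le_induction with
  | base => exact Or.inl fun k h1 h2 => by omega
  | succ b hab ih =>
    have harc : E (p b) (p (b + 1)) ∨ E (p (b + 1)) (p b) :=
      (adj_iff hE).1 ((hp.2 b (by omega) (b + 1) hb).2 (by omega))
    have hext : ∀ F : ℕ → Prop, (∀ k, a ≤ k → k < b → F k) → F b →
        ∀ k, a ≤ k → k < b + 1 → F k := fun F h1 h2 k hk1 hk2 => by
      rcases Nat.lt_succ_iff_lt_or_eq.1 hk2 with h | rfl
      exacts [h1 k hk1 h, h2]
    rcases hab.eq_or_lt with rfl | hab'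
    · exact harc.imp (hext _ fun k h1 h2 => by omega) (hext _ fun k h1 h2 => by omega)
    · have hb' : b - 1 + 1 = b := by omega
      have hno := hturn b hab' (by omega)
      rcases ih (by omega) fun k h1 h2 => hturn k h1 (by omega) with h | h
      · refine Or.inl (hext _ h (harc.resolve_right fun e => hno ?_))
        have h0 := h (b - 1) (by omega) (by omega)
        rw [hb'] at h0
        exact ⟨by omega, by omega, Or.inr ⟨h0, e⟩⟩
      · refine Or.inr (hext _ h (harc.resolve_left fun e => hno ?_))
        have h0 := h (b - 1) (by omega) (by omega)
        rw [hb'] at h0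
        exact ⟨by omega, by omega, Or.inl ⟨h0, e⟩⟩

theorem Attached.threads_of_succ (hE : ∀ u v, E u v → ¬ E v u)
    (hp : IndPath (SimpleGraph.fromRel E) p m) (hn : 2 ≤ n) (hD : CondD2 n E) {x : V} {i : ℕ}
    (h : Attached (SimpleGraph.fromRel E) p m x i (i + 1)) (hi : n ≤ i) (hj : i + 1 + n < m)
    (hturn : ∀ k, IsTurn E p m k → ¬ (i ≤ k + n ∧ k ≤ i + n)) : Threads E p x i (i + 1) := by
  have hf := h.fork_self hp hn hi hj (by omega)
  have hi' : i - 1 + 1 = i := by omega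
  have hk' : ∀ k, k + 1 < n → i - (k + 1) + 1 = i - k := fun k hk => by omega
  rcases hp.direction hE (a := i - n) (b := i + n) (by omega) (by omega)
    fun k h1 h2 ht => hturn k ht (by omega) with hd | hd
  · have h0 := hd (i - 1) (by omega) (by omega)
    rw [hi'] at h0
    refine Or.inl ⟨h0, hf.arcs hE hD (fun k hk => ?_)
      (fun k hk => hd (i + 1 + k) (by omega) (by omega)) (hd _ (by omega) (by omega))⟩
    have := hd (i - (k + 1)) (by omega) (by omega)
    rwa [hk' k hk] at this
  · have h0 := hd (i - 1) (by omega) (by omega)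
    rw [hi'] at h0
    refine Or.inr ⟨h0, (hf.symm.arcs hE hD (fun k hk => hd (i + 1 + k) (by omega) (by omega))
      (fun k hk => ?_) (hd _ (by omega) (by omega))).symm⟩
    have := hd (i - (k + 1)) (by omega) (by omega)
    rwa [hk' k hk] at this

/-- The vertices on the turn-free segment of `p` that starts in `p a`, together with the vertices
threaded through it. -/
def segmentSet (E : V → V → Prop) (p : ℕ → V) (m a : ℕ) : Set V :=
  {v | ∃ b < m, a ≤ b ∧ (∀ k, a < k → k < b → ¬ IsTurn E p m k) ∧
    ((∃ k, a ≤ k ∧ k ≤ b ∧ v = p k) ∨ ((∀ k < m, v ≠ p k) ∧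
      ∃ i j, a < i ∧ i < j ∧ j ≤ i + 3 ∧ j ≤ b ∧ Threads E p v i j))}

theorem pathCovered_segmentSet [Fintype V] (hE : ∀ u v, E u v → ¬ E v u)
    (hp : IndPath (SimpleGraph.fromRel E) p m)
    (hstar : ¬ HasInducedCopyG (StarG n) (SimpleGraph.fromRel E)) {a : ℕ} (ha : a < m) :
    PathCovered E (segmentSet E p m a) (1 + 4 * n) := by
  classical
  let P : ℕ → Prop := fun b => a ≤ b ∧ ∀ k, a < k → k < b → ¬ IsTurn E p m k
  set b := Nat.findGreatest P (m - 1) with hb_def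
  obtain ⟨hab, hturn⟩ : P b :=
    Nat.findGreatest_spec (m := a) (by omega) ⟨le_rfl, fun k h1 h2 => by omega⟩
  have hb : b < m := by
    have : b ≤ m - 1 := Nat.findGreatest_le _
    omega
  have hmax : ∀ c < m, P c → c ≤ b := fun c hc h => Nat.le_findGreatest (by omega) h
  have hα : ∀ v, IndepBound (SimpleGraph.fromRel E) {x | E v x} n := fun v =>
    indepBound_neighbors hstar v _ fun x hx => (adj_iff hE).2 (Or.inl hx)
  rcases hp.direction hE hab hb hturn with hd | hd
  · refine (PathCovered.of_detours hE (q := fun k => p (a + k)) (L := b - a)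
      (fun k hk l hl e => ?_) (fun k hk => hd _ (by omega) (by omega)) hα).mono ?_ le_rfl
    · have := hp.1 _ (by omega) _ (by omega) e
      omega
    · rintro v ⟨c, hc, hac, hct, ⟨k, hk, hkc, rfl⟩ | ⟨hne, i, j, hi, hij, hij', hj, ht⟩⟩
      · have := hmax c hc ⟨hac, hct⟩
        exact Or.inl ⟨k - a, by omega, by rw [show a + (k - a) = k by omega]⟩
      · have := hmax c hc ⟨hac, hct⟩
        refine Or.inr ⟨fun k hk => hne _ (by omega), i - a, j - a, by omega, by omega, by omega, ?_⟩
        rw [show a + (i - a) = i by omega, show a + (j - a) = j by omega]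
        have h0 := hd (i - 1) (by omega) (by omega)
        rw [show i - 1 + 1 = i by omega] at h0
        rcases ht with ht | ht
        exacts [ht.2, absurd ht.1 (hE _ _ h0)]
  · refine (PathCovered.of_detours hE (q := fun k => p (b - k)) (L := b - a)
      (fun k hk l hl e => ?_) (fun k hk => ?_) hα).mono ?_ le_rfl
    · have := hp.1 _ (by omega) _ (by omega) e
      omega
    · have := hd (b - (k + 1)) (by omega) (by omega)
      rwa [show b - (k + 1) + 1 = b - k by omega] at this
    · rintro v ⟨c, hc, hac, hct, ⟨k, hk, hkc, rfl⟩ | ⟨hne, i, j, hi, hij, hij', hj, ht⟩⟩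
      · have := hmax c hc ⟨hac, hct⟩
        exact Or.inl ⟨b - k, by omega, by rw [show b - (b - k) = k by omega]⟩
      · have := hmax c hc ⟨hac, hct⟩
        refine Or.inr ⟨fun k hk => hne _ (by omega), b - j, b - i, by omega, by omega, by omega, ?_⟩
        rw [show b - (b - i) = i by omega, show b - (b - j) = j by omega]
        have h0 := hd (i - 1) (by omega) (by omega)
        rw [show i - 1 + 1 = i by omega] at h0
        rcases ht with ht | ht
        exacts [absurd ht.1 (hE _ _ h0), ht.2.symm]

end Segments

/-! ### The bound on the path cover number -/

section Bound

variable {V : Type} {E : V → V → Prop} {p : ℕ → V} {m n : ℕ}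

theorem exists_longest_indPath [Fintype V] [Nonempty V] (G : SimpleGraph V) :
    ∃ p m, 0 < m ∧ IndPath G p m ∧ ∀ q r, IndPath G q r → r ≤ m := by
  classical
  let P : ℕ → Prop := fun m => ∃ p, IndPath G p m
  have hle : ∀ q r, IndPath G q r → r ≤ Fintype.card V := fun q r h => by
    simpa using Fintype.card_le_of_injective (fun k : Fin r => q k)
      fun a b e => Fin.ext (h.1 a a.2 b b.2 e)
  have hone : P 1 := ⟨fun _ => Classical.arbitrary V, fun a ha b hb _ => by omega,
    fun a ha b hb => iff_of_false (fun e => e.ne rfl) (by omega)⟩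
  obtain ⟨p, hp⟩ : P (Nat.findGreatest P (Fintype.card V)) :=
    Nat.findGreatest_spec Fintype.card_pos hone
  exact ⟨p, _, Nat.le_findGreatest Fintype.card_pos hone, hp,
    fun q r h => Nat.le_findGreatest (hle q r h) ⟨q, h⟩⟩

theorem IndPath.dist_le_of_near {G : SimpleGraph V} (hG : G.Connected) (hp : IndPath G p m)
    {a b c : ℕ} (ha : a < m) (hb : b < m) (hab : a ≤ b + c) (hba : b ≤ a + c) :
    G.dist (p a) (p b) ≤ c := by
  rcases le_total b a with h | h
  · have := hp.dist_le hG (a := b) (b := a - b) (by omega)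
    rw [show b + (a - b) = a by omega] at this
    omega
  · have := hp.dist_le hG (a := a) (b := b - a) (by omega)
    rw [show a + (b - a) = b by omega, SimpleGraph.dist_comm] at this
    omega

/-- Every vertex is close to an end of a longest induced path `p`, to one of its turns, or to one of
the centres `J` of bad bypasses, or it belongs to a segment between turns. -/
theorem near_or_mem_segmentSet (hE : ∀ u v, E u v → ¬ E v u)
    (hG : (SimpleGraph.fromRel E).Connected) (hn : 2 ≤ n) (h1 : CondD1 n E) (h2 : CondD2 n E)
    (hp : IndPath (SimpleGraph.fromRel E) p m) (hm : 0 < m)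
    (hmax : ∀ q r, IndPath (SimpleGraph.fromRel E) q r → r ≤ m) {J : Finset ℕ}
    (hJm : ∀ k ∈ J, k < m)
    (hJ : ∀ x i j, BadBypass E p m n x i j → ∃ k ∈ J, i < k + 10 ∧ k < i + 10) (v : V) :
    (∃ k, (k = 0 ∨ k = m - 1 ∨ IsTurn E p m k ∨ k ∈ J) ∧
      (SimpleGraph.fromRel E).dist v (p k) ≤ 2 * n + (n + 1) * (2 * n + 2) + 10) ∨
    ∃ t, (t = 0 ∨ IsTurn E p m t) ∧ v ∈ segmentSet E p m t := by
  classical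
  obtain ⟨-, hstar, hF1, hF2⟩ := h1
  have hseg : ∀ l, ∃ t, (t = 0 ∨ IsTurn E p m t) ∧ t ≤ l ∧
      ∀ k, t < k → k ≤ l → ¬ IsTurn E p m k := fun l => by
    let P : ℕ → Prop := fun t => t = 0 ∨ IsTurn E p m t
    refine ⟨Nat.findGreatest P l, Nat.findGreatest_spec (P := P) (Nat.zero_le l) (Or.inl rfl),
      Nat.findGreatest_le l, fun k hk hkl ht => ?_⟩
    exact absurd (Nat.le_findGreatest (P := P) hkl (Or.inr ht)) (by omega)
  by_cases hon : ∃ k < m, v = p k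
  · obtain ⟨l, hl, rfl⟩ := hon
    obtain ⟨t, ht, htl, hno⟩ := hseg l
    exact Or.inr ⟨t, ht, l, hl, htl, fun k hk hkl => hno k hk hkl.le, Or.inl ⟨l, htl, le_rfl, rfl⟩⟩
  push Not at hon
  by_cases hadj : ∃ k < m, (SimpleGraph.fromRel E).Adj v (p k)
  swap
  · push Not at hadj
    rcases dist_end_le hG hp hn hmax hstar hF1 hF2 hm hon hadj with h | h
    · exact Or.inl ⟨0, Or.inl rfl, h.trans (by omega)⟩
    · exact Or.inl ⟨m - 1, Or.inr (Or.inl rfl), h.trans (by omega)⟩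
  obtain ⟨i, j, h⟩ := exists_attached hon hadj
  have hle := h.le
  have hlt := h.lt
  have hnear : ∀ l k c, (SimpleGraph.fromRel E).Adj v (p l) → l < m → k < m → l ≤ k + c →
      k ≤ l + c → c + 1 ≤ 2 * n + 10 →
      (SimpleGraph.fromRel E).dist v (p k) ≤ 2 * n + (n + 1) * (2 * n + 2) + 10 := by
    intro l k c hvl hl hk hlk hkl hc
    have := dist_le_succ_of_adj hG (p k) hvl
    have := hp.dist_le_of_near hG hl hk hlk hkl
    have := Nat.zero_le ((n + 1) * (2 * n + 2))
    omega
  by_cases hi : i < n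
  · exact Or.inl ⟨0, Or.inl rfl, hnear i 0 n h.adj_fst (by omega) hm (by omega) (by omega)
      (by omega)⟩
  by_cases hj : m ≤ j + n
  · exact Or.inl ⟨m - 1, Or.inr (Or.inl rfl), hnear j (m - 1) n h.adj_lst hlt (by omega)
      (by omega) (by omega) (by omega)⟩
  push Not at hi hj
  by_cases hturn : ∃ k, IsTurn E p m k ∧ i ≤ k + (n + 5) ∧ k ≤ i + (n + 5)
  · obtain ⟨k, hk, hik, hki⟩ := hturn
    have := hk.2.1
    exact Or.inl ⟨k, Or.inr (Or.inr (Or.inl hk)), hnear i k (n + 5) h.adj_fst (by omega)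
      (by omega) hik hki (by omega)⟩
  push Not at hturn
  have hij := h.fst_lt_lst hp hn hF1 hi hj
  have hij' := h.lst_le hp hn hF1 hF2 hi hj
  by_cases hthr : Threads E p v i j
  · right
    obtain ⟨t, ht, hti, hno⟩ := hseg i
    have hti' : t ≠ i := by
      rintro rfl
      rcases ht with rfl | ht
      · omega
      · have := hturn t ht (by omega)
        omega
    refine ⟨t, ht, j, hlt, by omega, fun k hk hkj htk => ?_,
      Or.inr ⟨hon, i, j, by omega, hij, hij', le_rfl, hthr⟩⟩
    rcases le_or_gt k i with hki | hki
    · exact hno k hk hki htk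
    · have := hturn k htk (by omega)
      omega
  · left
    have hij2 : i + 2 ≤ j := by
      by_contra! hlt2
      obtain rfl : j = i + 1 := by omega
      refine hthr (h.threads_of_succ hE hp hn h2 hi hj fun k hk hki => ?_)
      have := hturn k hk (by omega)
      omega
    obtain ⟨k, hk, hik, hki⟩ := hJ v i j ⟨h, hi, hj, hij2, hij', hthr⟩
    exact ⟨k, Or.inr (Or.inr (Or.inr hk)), hnear i k 10 h.adj_fst (by omega) (hJm k hk) (by omega)
      (by omega) (by omega)⟩

theorem pcOn_univ_le [Fintype V] {a : ℕ} (hE : ∀ u v, E u v → ¬ E v u)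
    (hG : (SimpleGraph.fromRel E).Connected) (hn : 2 ≤ n) (h1 : CondD1 n E) (h2 : CondD2 n E)
    (h3 : CondD3 n E)
    (ha : ∀ v, IndepBound (SimpleGraph.fromRel E)
      {u | (SimpleGraph.fromRel E).dist u v ≤ 2 * n + (n + 1) * (2 * n + 2) + 10} a) :
    pcOn E Set.univ ≤ (2 * n + 2) * a + (n + 1) * (1 + 4 * n) := by
  classical
  have : Nonempty V := hG.nonempty
  obtain ⟨p, m, hm, hp, hmax⟩ := exists_longest_indPath (SimpleGraph.fromRel E)
  obtain ⟨J, hJn, hJm, hJ⟩ := exists_badBypass_centers hE hp hn h1.2.2.1 h3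
  let T : Finset ℕ := (Finset.range m).filter (IsTurn E p m)
  have hT : ∀ k, k ∈ T ↔ IsTurn E p m k := fun k =>
    ⟨fun h => (Finset.mem_filter.1 h).2, fun h => Finset.mem_filter.2
      ⟨Finset.mem_range.2 (by have := h.2.1; omega), h⟩⟩
  have hTn : T.card ≤ n := card_isTurn_le hE h3 hp fun k hk => (hT k).1 hk
  have hballs := PathCovered.biUnion (insert 0 (insert (m - 1) (T ∪ J))) fun k _ =>
    PathCovered.of_indepBound hE (ha (p k))
  have hsegs := PathCovered.biUnion (S := segmentSet E p m) (insert 0 T) fun t ht =>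
    pathCovered_segmentSet hE hp h1.2.1 (by
      rcases Finset.mem_insert.1 ht with rfl | ht
      · exact hm
      · have := ((hT t).1 ht).2.1
        omega)
  refine ((hballs.union hsegs).mono (fun v _ => ?_)
    (Nat.add_le_add (Nat.mul_le_mul_right _ ?_) (Nat.mul_le_mul_right _ ?_))).pcOn_le
  · rcases near_or_mem_segmentSet hE hG hn h1 h2 hp hm hmax hJm hJ v with ⟨k, hk, hv⟩ | ⟨t, ht, hv⟩
    · exact Or.inl ⟨k, by simpa [hT] using hk, hv⟩
    · exact Or.inr ⟨t, by simpa [hT] using ht, hv⟩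
  · have h1 := Finset.card_insert_le 0 (insert (m - 1) (T ∪ J))
    have h2 := Finset.card_insert_le (m - 1) (T ∪ J)
    have h3 := Finset.card_union_le T J
    omega
  · have := Finset.card_insert_le 0 T
    omega

end Bound

end DigraphPathCover

/-- For every `n ≥ 2` there is a constant `c₁ = c₁(n)` such that
`pc(D) ≤ c₁` for every weakly connected digraph `D` satisfying (D1), (D2) and (D3). -/
theorem pc_bounded_of_D1_D2_D3 (n : ℕ) (hn : 2 ≤ n) :
    ∃ c : ℕ, ∀ (V : Type) (_ : Fintype V) (E : V → V → Prop),
      (∀ u v : V, E u v → ¬ E v u) →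
      (SimpleGraph.fromRel E).Connected →
      CondD1 n E → CondD2 n E → CondD3 n E →
      pcOn E Set.univ ≤ c := by
  obtain ⟨a, ha⟩ :=
    DigraphPathCover.exists_indepBound_ball n (2 * n + (n + 1) * (2 * n + 2) + 10)
  exact ⟨(2 * n + 2) * a + (n + 1) * (1 + 4 * n), fun V _ E hE hG h1 h2 h3 =>
    DigraphPathCover.pcOn_univ_le hE hG hn h1 h2 h3 (ha V _ h1.1 h1.2.1 hG)⟩
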